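/- Fix an integer d ≥ 2 and for each integer H ≥ 2 set y_d(H) = 2·c_d·K₁(d)·ζ(d+1)·(log H)^{l(d)}/H. If H ≥ 2 is such that y_d(H) ≤ 1/2, then for every subinterval I ⊂ [0,1], |λ'_H(I) − ∫_I χ_d| ≤ 5·y_d(H), where λ'_H = (1/#(𝔸_d(H) ∩ [0,1]))·Σ_{α ∈ 𝔸_d(H) ∩ [0,1]} δ_α is the uniform probability measure on 𝔸_d(H) ∩ [0,1]. -/

import Mathlib

open MeasureTheory Set

noncomputable section

def lfun (d : ℕ) : ℕ := if d = 2 then 1 else 0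

def algSet (d : ℕ) (H : ℝ) : Set ℝ :=
  {α : ℝ | ∃ P : Polynomial ℤ, Irreducible P ∧ P.natDegree = d ∧
    (∀ k, |(P.coeff k : ℝ)| ≤ H) ∧ Polynomial.aeval α P = 0}

def DeltaDom (d : ℕ) (x : ℝ) : Set (Fin d → ℝ) :=
  {p | (∀ k, |p k| ≤ 1) ∧ |∑ k : Fin d, p k * x ^ ((k : ℕ) + 1)| ≤ 1}

/-- Koleda's density function `ρ_d`. -/
def rho (d : ℕ) (x : ℝ) : ℝ :=
  ∫ p in DeltaDom d x, |∑ k : Fin d, (((k : ℕ) : ℝ) + 1) * p k * x ^ (k : ℕ)|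

def cK (d : ℕ) : ℝ := (∫ x in (0 : ℝ)..1, rho d x)⁻¹

def chiF (d : ℕ) (x : ℝ) : ℝ := cK d * rho d x

def zetaR (s : ℕ) : ℝ := ∑' n : ℕ, (1 : ℝ) / ((n : ℝ) + 1) ^ s

def pK (d : ℕ) : ℕ := 4 ^ ((4 ^ (d + 1) - 1) / 3) * d ^ (4 ^ (d + 1))

def sK (d : ℕ) : ℕ :=
  3 * (2 * d + 3) ^ (2 ^ (d + 1)) *
    d ^ ((16 ^ (d + 1) - 1) * ⌈Real.log d / Real.log 2⌉₊)

def K1 (d : ℕ) : ℝ :=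
  (d : ℝ) * (12 * (d : ℝ) ^ 2 * 2 ^ (d * (d - 2)) * ((d : ℝ) + 1) ^ ((d : ℝ) / 2)
    + 2 ^ (d + 2) * (pK d : ℝ) * (2 * (pK d : ℝ) - 1) ^ sK d)

/-- `y_d(H) = 2 c_d K₁(d) ζ(d+1) (log H)^{l(d)} / H`. -/
def yd (d H : ℕ) : ℝ :=
  2 * cK d * K1 d * zetaR (d + 1) * Real.log H ^ lfun d / H

/-- The uniform probability measure `λ'_H` on `𝔸_d(H) ∩ [0,1]`, evaluated on `I`. -/
def lambdaP (d H : ℕ) (I : Set ℝ) : ℝ :=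
  (Set.ncard {α : ℝ | α ∈ algSet d H ∧ α ∈ Set.Icc 0 1 ∧ α ∈ I} : ℝ) /
    (Set.ncard (algSet d H ∩ Set.Icc 0 1) : ℝ)

set_option linter.unusedVariables false

lemma ak_int_count (J : Set ℝ) (hJ : J.OrdConnected) (A B : ℝ) (hAB : J ⊆ Icc A B) :
    |(Set.ncard {m : ℤ | (m : ℝ) ∈ J} : ℝ) - (volume J).toReal| ≤ 1 := by
  rcases J.eq_empty_or_nonempty with rfl | hne
  · simp
  have hbb : BddBelow J := bddBelow_Icc.mono hAB
  have hba : BddAbove J := bddAbove_Icc.mono hAB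
  set a := sInf J
  set b := sSup J
  have hab : a ≤ b := csInf_le_csSup hne hbb hba
  have h1 : J ⊆ Icc a b := fun x hx => ⟨csInf_le hbb hx, le_csSup hba hx⟩
  have h2 : Ioo a b ⊆ J := by
    intro x hx
    obtain ⟨u, hu, hux⟩ := exists_lt_of_csInf_lt hne hx.1
    obtain ⟨v, hv, hxv⟩ := exists_lt_of_lt_csSup hne hx.2
    exact hJ.out hu hv ⟨hux.le, hxv.le⟩
  have hvol : (volume J).toReal = b - a := by
    have e1 : volume J ≤ ENNReal.ofReal (b - a) := by
      simpa using measure_mono (μ := volume) h1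
    have e2 : ENNReal.ofReal (b - a) ≤ volume J := by
      simpa using measure_mono (μ := volume) h2
    rw [le_antisymm e1 e2, ENNReal.toReal_ofReal (by linarith)]
  rw [hvol]
  have s1 : {m : ℤ | (m : ℝ) ∈ J} ⊆ ((Finset.Icc ⌈a⌉ ⌊b⌋ : Finset ℤ) : Set ℤ) := by
    intro m hm
    have := h1 hm
    simp only [Finset.coe_Icc, Set.mem_Icc]
    exact ⟨Int.ceil_le.2 this.1, Int.le_floor.2 this.2⟩
  have s2 : ((Finset.Ioo ⌊a⌋ ⌈b⌉ : Finset ℤ) : Set ℤ) ⊆ {m : ℤ | (m : ℝ) ∈ J} := by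
    intro m hm
    simp only [Finset.coe_Ioo, Set.mem_Ioo] at hm
    exact h2 ⟨Int.floor_lt.1 hm.1, Int.lt_ceil.1 hm.2⟩
  have c1 := Set.ncard_le_ncard s1 (Finset.finite_toSet _)
  have c2 := Set.ncard_le_ncard s2 ((Finset.finite_toSet _).subset s1)
  rw [Set.ncard_coe_finset] at c1 c2
  rw [Int.card_Icc] at c1
  rw [Int.card_Ioo] at c2
  have f1 := Int.ceil_lt_add_one a
  have f2 := Int.le_ceil a
  have f3 := Int.floor_le a
  have f4 := Int.lt_floor_add_one a
  have g1 := Int.ceil_lt_add_one b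
  have g2 := Int.le_ceil b
  have g3 := Int.floor_le b
  have g4 := Int.lt_floor_add_one b
  set N := Set.ncard {m : ℤ | (m : ℝ) ∈ J}
  have c2' : (⌈b⌉ - ⌊a⌋ - 1 : ℤ) ≤ N := by omega
  have c2r : ((⌈b⌉ : ℝ) - ⌊a⌋ - 1) ≤ N := by exact_mod_cast c2'
  have c1' : (N : ℝ) ≤ b - a + 1 := by
    rcases le_or_gt (⌊b⌋ + 1 - ⌈a⌉) 0 with h | h
    · have : N = 0 := by omega
      rw [this]; push_cast; linarith
    · have : (N : ℤ) ≤ ⌊b⌋ + 1 - ⌈a⌉ := by omega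
      have : (N : ℝ) ≤ (⌊b⌋ : ℝ) + 1 - ⌈a⌉ := by exact_mod_cast this
      linarith
  rw [abs_le]
  constructor <;> linarith

open Polynomial in
lemma ak_fin_fiber (f : ℝ[X]) (hf : derivative f ≠ 0) (I : Set ℝ) (c : ℝ) :
    {x ∈ I | f.eval x = c}.Finite := by
  have h0 : f - C c ≠ 0 := by
    intro h
    apply hf
    rw [sub_eq_zero.1 h]; simp
  refine (Polynomial.finite_setOfPred_isRoot h0).subset ?_
  rintro x ⟨_, hx⟩
  simp [hx]

open Polynomial in
lemma ak_integrand_int (f : ℝ[X]) (I : Set ℝ) (hI : I ⊆ Icc 0 1) (hm : MeasurableSet I) (H : ℝ) :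
    IntegrableOn (fun x => if |f.eval x| ≤ H then |(derivative f).eval x| else 0) I := by
  have h1 : IntegrableOn (fun x => |(derivative f).eval x|) (Icc (0:ℝ) 1) :=
    (Continuous.continuousOn (by fun_prop)).integrableOn_Icc
  have h2 := (h1.mono_set hI)
  have hms : MeasurableSet {x : ℝ | |f.eval x| ≤ H} :=
    measurableSet_le (by fun_prop) measurable_const
  have := h2.indicator hms
  refine this.congr (Filter.Eventually.of_forall fun x => ?_)
  simp [Set.indicator]

open Polynomial in
lemma ak_base (f : ℝ[X]) (hf : derivative f ≠ 0) (I : Set ℝ) (hI : I ⊆ Icc 0 1)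
    (hc : I.OrdConnected) (H : ℕ) (h0 : ∀ x ∈ I, (derivative f).eval x ≠ 0) :
    |(∑ m ∈ Finset.Icc (-(H:ℤ)) H, (Set.ncard {x ∈ I | f.eval x = (m:ℝ)} : ℝ)) -
      ∫ x in I, (if |f.eval x| ≤ (H:ℝ) then |(derivative f).eval x| else 0)| ≤ 1 := by
  have hinj : InjOn (fun x => f.eval x) I := by
    have key : ∀ a ∈ I, ∀ b ∈ I, a < b → f.eval a ≠ f.eval b := by
      intro a ha b hb hlt heq
      obtain ⟨c, hc1, hc2⟩ := exists_deriv_eq_zero (f := fun x => f.eval x) hlt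
        (by fun_prop) heq
      rw [Polynomial.deriv] at hc2
      exact h0 c (hc.out ha hb ⟨hc1.1.le, hc1.2.le⟩) hc2
    intro a ha b hb heq
    by_contra hne
    rcases lt_or_gt_of_ne hne with h | h
    · exact key a ha b hb h heq
    · exact key b hb a ha h heq.symm
  have hmeas : MeasurableSet I := hc.measurableSet
  set J : Set ℝ := ((fun x => f.eval x) '' I) ∩ Icc (-(H:ℝ)) H with hJ
  have hJc : J.OrdConnected := by
    have : IsPreconnected ((fun x => f.eval x) '' I) :=
      (hc.isPreconnected).image _ (by fun_prop)
    exact (this.ordConnected).inter ordConnected_Icc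
  have hintg : ∫ x in I, (if |f.eval x| ≤ (H:ℝ) then |(derivative f).eval x| else 0)
      = (volume J).toReal := by
    have := integral_image_eq_integral_abs_deriv_smul (s := I) (f := fun x => f.eval x)
      (f' := fun x => (derivative f).eval x) hmeas
      (fun x _ => (f.hasDerivAt x).hasDerivWithinAt) hinj
      ((Icc (-(H:ℝ)) H).indicator (fun _ => (1:ℝ)))
    rw [setIntegral_indicator measurableSet_Icc] at this
    rw [← hJ] at this
    simp only [integral_const, smul_eq_mul, mul_one] at this
    rw [measureReal_restrict_apply_univ] at this
    rw [← measureReal_def, this]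
    congr 1
    ext x
    simp only [Set.indicator, Set.mem_Icc, ← abs_le]
    split_ifs <;> simp
  have hsum : (∑ m ∈ Finset.Icc (-(H:ℤ)) H, (Set.ncard {x ∈ I | f.eval x = (m:ℝ)} : ℝ))
      = (Set.ncard {m : ℤ | (m : ℝ) ∈ J} : ℝ) := by
    classical
    have e1 : ∀ m : ℤ, Set.ncard {x ∈ I | f.eval x = (m:ℝ)} =
        if (m:ℝ) ∈ (fun x => f.eval x) '' I then 1 else 0 := by
      intro m
      split_ifs with h
      · obtain ⟨x, hx, hxm⟩ := h
        rw [Set.ncard_eq_one]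
        refine ⟨x, ?_⟩
        ext z
        simp only [Set.mem_ofPred_eq, Set.mem_singleton_iff]
        constructor
        · rintro ⟨hz, hzm⟩
          exact hinj hz hx (hzm.trans hxm.symm)
        · rintro rfl; exact ⟨hx, hxm⟩
      · have : {x ∈ I | f.eval x = (m:ℝ)} = ∅ := by
          ext z
          simp only [Set.mem_ofPred_eq, Set.mem_empty_iff_false, iff_false]
          rintro ⟨hz, hzm⟩
          exact h ⟨z, hz, hzm⟩
        rw [this]; simp
    have e2 : {m : ℤ | (m : ℝ) ∈ J} = (((Finset.Icc (-(H:ℤ)) H).filter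
        (fun m : ℤ => (m:ℝ) ∈ (fun x => f.eval x) '' I) : Finset ℤ) : Set ℤ) := by
      ext m
      simp only [hJ, Set.mem_inter_iff, Set.mem_ofPred_eq, Finset.coe_filter, Finset.mem_Icc,
        Set.mem_Icc]
      have : (-(H:ℝ) ≤ m ∧ (m:ℝ) ≤ H) ↔ (-(H:ℤ) ≤ m ∧ m ≤ H) := by
        constructor
        · rintro ⟨h1, h2⟩; exact ⟨by exact_mod_cast h1, by exact_mod_cast h2⟩
        · rintro ⟨h1, h2⟩; exact ⟨by exact_mod_cast h1, by exact_mod_cast h2⟩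
      tauto
    rw [e2, Set.ncard_coe_finset, Finset.card_filter]
    push_cast
    refine Finset.sum_congr rfl fun m _ => ?_
    rw [e1 m]
    split_ifs <;> simp
  rw [hintg, hsum]
  exact ak_int_count J hJc (-(H:ℝ)) H Set.inter_subset_right

open Polynomial in
lemma ak_indicatrix (f : ℝ[X]) (hf : derivative f ≠ 0) (H : ℕ) (k : ℕ) :
    ∀ (I : Set ℝ) (_ : I ⊆ Icc 0 1) (_ : I.OrdConnected)
      (_ : Set.ncard {x ∈ I | (derivative f).eval x = 0} ≤ k),
    |(∑ m ∈ Finset.Icc (-(H:ℤ)) H, (Set.ncard {x ∈ I | f.eval x = (m:ℝ)} : ℝ)) -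
      ∫ x in I, (if |f.eval x| ≤ (H:ℝ) then |(derivative f).eval x| else 0)| ≤ 2 *
        (Set.ncard {x ∈ I | (derivative f).eval x = 0}) + 1 := by
  have hfin : ∀ I : Set ℝ, {x ∈ I | (derivative f).eval x = 0}.Finite := fun I =>
    (Polynomial.finite_setOfPred_isRoot hf).subset (fun x hx => hx.2)
  induction k with
  | zero =>
    intro I hI hc hk
    have hz : Set.ncard {x ∈ I | (derivative f).eval x = 0} = 0 := by omega
    rw [hz]
    rw [Set.ncard_eq_zero (hfin I)] at hz
    have := ak_base f hf I hI hc H (fun x hx h => by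
      have : x ∈ {x ∈ I | (derivative f).eval x = 0} := ⟨hx, h⟩
      rw [hz] at this; exact this)
    simpa using this
  | succ k ih =>
    intro I hI hc hk
    by_cases hex : ∃ z ∈ I, (derivative f).eval z = 0
    swap
    · push Not at hex
      have := ak_base f hf I hI hc H hex
      refine this.trans ?_
      have : (0:ℝ) ≤ (Set.ncard {x ∈ I | (derivative f).eval x = 0}) := by positivity
      linarith
    obtain ⟨z, hzI, hz⟩ := hex
    set I1 := I ∩ Iio z
    set I2 := I ∩ Ioi z
    have hI1 : I1 ⊆ Icc 0 1 := inter_subset_left.trans hI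
    have hI2 : I2 ⊆ Icc 0 1 := inter_subset_left.trans hI
    have hc1 : I1.OrdConnected := hc.inter ordConnected_Iio
    have hc2 : I2.OrdConnected := hc.inter ordConnected_Ioi
    have hsplit : ∀ (Q : ℝ → Prop), {x ∈ I | Q x}.Finite →
        Set.ncard {x ∈ I | Q x} = Set.ncard {x ∈ I1 | Q x} + Set.ncard {x ∈ I2 | Q x}
          + Set.ncard {x ∈ ({z} : Set ℝ) | Q x} := by
      intro Q hQ
      have e : {x ∈ I | Q x} = ({x ∈ I1 | Q x} ∪ {x ∈ I2 | Q x}) ∪ {x ∈ ({z} : Set ℝ) | Q x} := by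
        ext x
        simp only [I1, I2, Set.mem_union, Set.mem_ofPred_eq, Set.mem_inter_iff, Set.mem_Iio,
          Set.mem_Ioi, Set.mem_singleton_iff]
        constructor
        · rintro ⟨h1, h2⟩
          rcases lt_trichotomy x z with h | h | h
          · exact Or.inl (Or.inl ⟨⟨h1, h⟩, h2⟩)
          · exact Or.inr ⟨h, h2⟩
          · exact Or.inl (Or.inr ⟨⟨h1, h⟩, h2⟩)
        · rintro ((h | h) | h)
          · exact ⟨h.1.1, h.2⟩
          · exact ⟨h.1.1, h.2⟩
          · exact ⟨h.1 ▸ hzI, h.2⟩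
      have f1 : {x ∈ I1 | Q x}.Finite := hQ.subset (fun x hx => ⟨hx.1.1, hx.2⟩)
      have f2 : {x ∈ I2 | Q x}.Finite := hQ.subset (fun x hx => ⟨hx.1.1, hx.2⟩)
      have f3 : {x ∈ ({z} : Set ℝ) | Q x}.Finite := (Set.finite_singleton z).subset (fun x hx => hx.1)
      rw [e, Set.ncard_union_eq _ (f1.union f2) f3, Set.ncard_union_eq _ f1 f2]
      · rw [Set.disjoint_left]
        rintro x ⟨⟨_, h⟩, _⟩ ⟨⟨_, h'⟩, _⟩
        exact lt_asymm (Set.mem_Iio.1 h) (Set.mem_Ioi.1 h')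
      · rw [Set.disjoint_left]
        rintro x (⟨⟨_, h⟩, _⟩ | ⟨⟨_, h⟩, _⟩) ⟨h', _⟩
        · rw [Set.mem_singleton_iff] at h'; exact absurd h (by simp [h'])
        · rw [Set.mem_singleton_iff] at h'; exact absurd h (by simp [h'])
    have hD := hsplit (fun x => (derivative f).eval x = 0) (hfin I)
    have hD3 : Set.ncard {x ∈ ({z} : Set ℝ) | (derivative f).eval x = 0} = 1 := by
      rw [Set.ncard_eq_one]
      refine ⟨z, ?_⟩
      ext x
      simp only [Set.mem_ofPred_eq, Set.mem_singleton_iff]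
      constructor
      · exact fun h => h.1
      · rintro rfl; exact ⟨rfl, hz⟩
    rw [hD3] at hD
    have i1 := ih I1 hI1 hc1 (by omega)
    have i2 := ih I2 hI2 hc2 (by omega)
    have hS : (∑ m ∈ Finset.Icc (-(H:ℤ)) H, (Set.ncard {x ∈ I | f.eval x = (m:ℝ)} : ℝ)) =
        (∑ m ∈ Finset.Icc (-(H:ℤ)) H, (Set.ncard {x ∈ I1 | f.eval x = (m:ℝ)} : ℝ)) +
        (∑ m ∈ Finset.Icc (-(H:ℤ)) H, (Set.ncard {x ∈ I2 | f.eval x = (m:ℝ)} : ℝ)) +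
        (∑ m ∈ Finset.Icc (-(H:ℤ)) H, (Set.ncard {x ∈ ({z}: Set ℝ) | f.eval x = (m:ℝ)} : ℝ)) := by
      rw [← Finset.sum_add_distrib, ← Finset.sum_add_distrib]
      refine Finset.sum_congr rfl fun m _ => ?_
      exact_mod_cast hsplit (fun x => f.eval x = (m:ℝ)) (ak_fin_fiber f hf I m)
    have hS3 : (∑ m ∈ Finset.Icc (-(H:ℤ)) H,
        (Set.ncard {x ∈ ({z}: Set ℝ) | f.eval x = (m:ℝ)} : ℝ)) ≤ 1 := by
      classical
      have e1 : ∀ m : ℤ, (Set.ncard {x ∈ ({z}: Set ℝ) | f.eval x = (m:ℝ)} : ℝ) ≤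
          if m = ⌊f.eval z⌋ then 1 else 0 := by
        intro m
        split_ifs with h
        · have : Set.ncard {x ∈ ({z}: Set ℝ) | f.eval x = (m:ℝ)} ≤ Set.ncard ({z} : Set ℝ) :=
            Set.ncard_le_ncard (fun x hx => hx.1)
          rw [Set.ncard_singleton] at this
          exact_mod_cast this
        · have : {x ∈ ({z}: Set ℝ) | f.eval x = (m:ℝ)} = ∅ := by
            ext x
            simp only [Set.mem_ofPred_eq, Set.mem_empty_iff_false, iff_false]
            rintro ⟨hx, hxm⟩
            rw [Set.mem_singleton_iff] at hx
            subst hx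
            apply h; rw [hxm]; simp
          rw [this]; simp
      refine (Finset.sum_le_sum fun m _ => e1 m).trans ?_
      rw [Finset.sum_ite_eq']
      split_ifs <;> norm_num
    have hS3' : (0:ℝ) ≤ (∑ m ∈ Finset.Icc (-(H:ℤ)) H,
        (Set.ncard {x ∈ ({z}: Set ℝ) | f.eval x = (m:ℝ)} : ℝ)) :=
      Finset.sum_nonneg fun _ _ => by positivity
    have hInt : ∫ x in I, (if |f.eval x| ≤ (H:ℝ) then |(derivative f).eval x| else 0) =
        (∫ x in I1, (if |f.eval x| ≤ (H:ℝ) then |(derivative f).eval x| else 0)) +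
        ∫ x in I2, (if |f.eval x| ≤ (H:ℝ) then |(derivative f).eval x| else 0) := by
      rw [← setIntegral_union _ hc2.measurableSet
        (ak_integrand_int f I1 hI1 hc1.measurableSet H)
        (ak_integrand_int f I2 hI2 hc2.measurableSet H)]
      · apply setIntegral_congr_set
        have e : I = (I1 ∪ I2) ∪ {z} := by
          ext x
          simp only [I1, I2, Set.mem_union, Set.mem_inter_iff, Set.mem_Iio,
            Set.mem_Ioi, Set.mem_singleton_iff]
          constructor
          · intro h1
            rcases lt_trichotomy x z with h | h | h
            · exact Or.inl (Or.inl ⟨h1, h⟩)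
            · exact Or.inr h
            · exact Or.inl (Or.inr ⟨h1, h⟩)
          · rintro ((h | h) | h)
            · exact h.1
            · exact h.1
            · exact h ▸ hzI
        have h3 : (I1 ∪ I2 ∪ {z} : Set ℝ) =ᵐ[volume] (I1 ∪ I2 : Set ℝ) :=
          union_ae_eq_left_of_ae_eq_empty (by simp [ae_eq_empty])
        rw [← e] at h3
        exact h3
      · rw [Set.disjoint_left]
        rintro x ⟨_, h⟩ ⟨_, h'⟩
        exact lt_asymm (Set.mem_Iio.1 h) (Set.mem_Ioi.1 h')
    rw [hS, hInt, hD]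
    push_cast
    rw [abs_le] at i1 i2 ⊢
    constructor <;> linarith [i1.1, i1.2, i2.1, i2.2]

def akD (d : ℕ) (x : ℝ) (p : Fin d → ℝ) : ℝ := ∑ k : Fin d, (((k : ℕ) : ℝ) + 1) * p k * x ^ (k : ℕ)
def akL (d : ℕ) (x : ℝ) (p : Fin d → ℝ) : ℝ := ∑ k : Fin d, p k * x ^ ((k : ℕ) + 1)
def akPhi (d : ℕ) (x H : ℝ) (p : Fin d → ℝ) : ℝ := if |akL d x p| ≤ H then |akD d x p| else 0
open Classical in
def akF (d : ℕ) (x H : ℝ) (p : Fin d → ℝ) : ℝ := if ∀ k, |p k| ≤ H then akPhi d x H p else 0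
def akBox (d H : ℕ) : Finset (Fin d → ℤ) := Fintype.piFinset (fun _ => Finset.Icc (-(H:ℤ)) H)
def akCube (d : ℕ) (p : Fin d → ℤ) : Set (Fin d → ℝ) :=
  Set.pi univ (fun k => Ico (p k : ℝ) ((p k : ℝ) + 1))

lemma ak_mem_box {d H : ℕ} {v : Fin d → ℤ} : v ∈ akBox d H ↔ ∀ k, |v k| ≤ H := by
  simp [akBox, Fintype.mem_piFinset, abs_le]

lemma ak_card_box (d H : ℕ) : (akBox d H).card = (2 * H + 1) ^ d := by
  rw [akBox, Fintype.card_piFinset]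
  simp only [Int.card_Icc, Finset.prod_const, Finset.card_univ, Fintype.card_fin]
  congr 1
  omega

lemma ak_D_le (d : ℕ) (x : ℝ) (hx : x ∈ Icc (0:ℝ) 1) (p : Fin d → ℝ) (B : ℝ) (hB : 0 ≤ B)
    (hp : ∀ k, |p k| ≤ B) : |akD d x p| ≤ (d:ℝ) ^ 2 * B := by
  have : |akD d x p| ≤ ∑ k : Fin d, (d:ℝ) * B := by
    refine (Finset.abs_sum_le_sum_abs _ _).trans (Finset.sum_le_sum fun k _ => ?_)
    have h1 : |x ^ (k:ℕ)| ≤ 1 := by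
      rw [abs_of_nonneg (pow_nonneg hx.1 _)]; exact pow_le_one₀ hx.1 hx.2
    have h2 : |((k:ℕ):ℝ) + 1| ≤ d := by
      rw [abs_of_nonneg (by positivity)]
      have := k.2
      exact_mod_cast this
    rw [abs_mul, abs_mul]
    calc |((k:ℕ):ℝ) + 1| * |p k| * |x ^ (k:ℕ)| ≤ d * B * 1 := by
          gcongr
          exact hp k
      _ = d * B := by ring
  refine this.trans (le_of_eq ?_)
  simp; ring

lemma ak_L_le (d : ℕ) (x : ℝ) (hx : x ∈ Icc (0:ℝ) 1) (p : Fin d → ℝ) (B : ℝ) (hB : 0 ≤ B)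
    (hp : ∀ k, |p k| ≤ B) : |akL d x p| ≤ (d:ℝ) * B * x := by
  have : |akL d x p| ≤ ∑ k : Fin d, B * x := by
    refine (Finset.abs_sum_le_sum_abs _ _).trans (Finset.sum_le_sum fun k _ => ?_)
    have h1 : |x ^ ((k:ℕ) + 1)| ≤ x := by
      rw [abs_of_nonneg (pow_nonneg hx.1 _), pow_succ]
      have := pow_le_one₀ (n := (k:ℕ)) hx.1 hx.2
      nlinarith [hx.1]
    rw [abs_mul]
    gcongr
    exact hp k
  refine this.trans (le_of_eq ?_)
  simp; ring

lemma ak_D_sub (d : ℕ) (x : ℝ) (p q : Fin d → ℝ) : akD d x p - akD d x q = akD d x (p - q) := by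
  simp only [akD, ← Finset.sum_sub_distrib, Pi.sub_apply]
  exact Finset.sum_congr rfl fun _ _ => by ring

lemma ak_L_sub (d : ℕ) (x : ℝ) (p q : Fin d → ℝ) : akL d x p - akL d x q = akL d x (p - q) := by
  simp only [akL, ← Finset.sum_sub_distrib, Pi.sub_apply]
  exact Finset.sum_congr rfl fun _ _ => by ring

lemma ak_D_smul (d : ℕ) (x c : ℝ) (p : Fin d → ℝ) : akD d x (c • p) = c * akD d x p := by
  simp only [akD, Finset.mul_sum, Pi.smul_apply, smul_eq_mul]
  exact Finset.sum_congr rfl fun _ _ => by ring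

lemma ak_L_smul (d : ℕ) (x c : ℝ) (p : Fin d → ℝ) : akL d x (c • p) = c * akL d x p := by
  simp only [akL, Finset.mul_sum, Pi.smul_apply, smul_eq_mul]
  exact Finset.sum_congr rfl fun _ _ => by ring

lemma ak_F_meas (d : ℕ) (H : ℝ) : Measurable (fun z : ℝ × (Fin d → ℝ) => akF d z.1 H z.2) := by
  unfold akF akPhi akL akD
  refine Measurable.ite ?_ (Measurable.ite ?_ ?_ ?_) measurable_const
  · have : {a : ℝ × (Fin d → ℝ) | ∀ k, |a.2 k| ≤ H} = ⋂ k, {a | |a.2 k| ≤ H} := by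
      ext; simp
    rw [this]
    refine MeasurableSet.iInter fun k => measurableSet_le (by fun_prop) measurable_const
  · exact measurableSet_le (by fun_prop) measurable_const
  · fun_prop
  · exact measurable_const

lemma ak_F_nonneg (d : ℕ) (x H : ℝ) (p : Fin d → ℝ) : 0 ≤ akF d x H p := by
  unfold akF akPhi
  split_ifs <;> positivity

lemma ak_F_le (d : ℕ) (x H : ℝ) (hH : 0 ≤ H) (hx : x ∈ Icc (0:ℝ) 1) (p : Fin d → ℝ) :
    akF d x H p ≤ (d:ℝ) ^ 2 * H := by
  unfold akF akPhi
  split_ifs with h1 h2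
  · exact ak_D_le d x hx p H hH h1
  · positivity
  · positivity

lemma ak_F_supp (d : ℕ) (x H : ℝ) (p : Fin d → ℝ) (hp : p ∉ Icc (fun _ => -H) (fun _ => H)) :
    akF d x H p = 0 := by
  unfold akF
  rw [if_neg]
  intro h
  apply hp
  exact ⟨fun k => (abs_le.1 (h k)).1, fun k => (abs_le.1 (h k)).2⟩

lemma ak_F_int (d : ℕ) (x H : ℝ) (hH : 0 ≤ H) (hx : x ∈ Icc (0:ℝ) 1) :
    Integrable (akF d x H) := by
  have hs : (Function.support (akF d x H)) ⊆ Icc (fun _ => -H) (fun _ => H) := by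
    intro p hp
    by_contra hcon
    exact hp (ak_F_supp d x H p hcon)
  rw [← integrableOn_iff_integrable_of_support_subset hs]
  have hm : Measurable (akF d x H) := (ak_F_meas d H).comp (measurable_prodMk_left)
  refine Measure.integrableOn_of_bounded (M := (d:ℝ)^2 * H) ?_ hm.aestronglyMeasurable ?_
  · exact (isCompact_Icc.measure_lt_top).ne
  · refine Filter.Eventually.of_forall fun p => ?_
    rw [Real.norm_of_nonneg (ak_F_nonneg _ _ _ _)]
    exact ak_F_le d x H hH hx p

lemma ak_rho_eq (d : ℕ) (x : ℝ) : rho d x = ∫ p, akF d x 1 p := by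
  have hms : MeasurableSet (DeltaDom d x) := by
    have : DeltaDom d x = (⋂ k, {p | |p k| ≤ 1}) ∩ {p | |∑ k : Fin d, p k * x ^ ((k : ℕ) + 1)| ≤ 1} := by
      ext; simp [DeltaDom]
    rw [this]
    refine MeasurableSet.inter (MeasurableSet.iInter fun k => ?_) ?_
    · exact measurableSet_le (by fun_prop) measurable_const
    · exact measurableSet_le (by fun_prop) measurable_const
  unfold rho
  rw [← integral_indicator hms]
  congr 1
  ext p
  unfold akF akPhi akD akL
  by_cases h : p ∈ DeltaDom d x
  · rw [Set.indicator_of_mem h, if_pos h.1, if_pos h.2]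
  · rw [Set.indicator_of_notMem h]
    by_cases h1 : ∀ k, |p k| ≤ 1
    · rw [if_pos h1, if_neg]
      intro h2; exact h ⟨h1, h2⟩
    · rw [if_neg h1]

lemma ak_rho_scale (d : ℕ) (x : ℝ) (H : ℝ) (hH : 0 < H) :
    H ^ (d+1) * rho d x = ∫ p, akF d x H p := by
  have h := Measure.integral_comp_smul (μ := (volume : Measure (Fin d → ℝ))) (akF d x H) H
  have e : ∀ p : Fin d → ℝ, akF d x H (H • p) = H * akF d x 1 p := by
    intro p
    unfold akF akPhi
    rw [ak_L_smul, ak_D_smul, abs_mul, abs_mul, abs_of_pos hH]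
    have e1 : (∀ k, |(H • p) k| ≤ H) ↔ ∀ k, |p k| ≤ 1 := by
      refine forall_congr' fun k => ?_
      rw [Pi.smul_apply, smul_eq_mul, abs_mul, abs_of_pos hH]
      constructor
      · intro h; nlinarith
      · intro h; nlinarith
    have e2 : (H * |akL d x p| ≤ H) ↔ |akL d x p| ≤ 1 := by
      constructor
      · intro h; nlinarith
      · intro h; nlinarith
    simp only [e1, e2]
    split_ifs <;> simp
  simp_rw [e] at h
  rw [integral_const_mul, ← ak_rho_eq] at h
  simp only [Module.finrank_fintype_fun_eq_card, Fintype.card_fin, smul_eq_mul] at h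
  rw [abs_of_pos (by positivity)] at h
  rw [pow_succ, mul_assoc, h]
  field_simp

lemma ak_rho_nonneg (d : ℕ) (x : ℝ) : 0 ≤ rho d x := by
  rw [ak_rho_eq]; exact integral_nonneg fun p => ak_F_nonneg d x 1 p

lemma ak_rho_le (d : ℕ) (x : ℝ) (hx : x ∈ Icc (0:ℝ) 1) : rho d x ≤ 2 ^ d * (d:ℝ) ^ 2 := by
  rw [ak_rho_eq, ← setIntegral_eq_integral_of_forall_compl_eq_zero
    (s := Icc (fun _ => -1) (fun _ => 1)) (fun p hp => ak_F_supp d x 1 p hp)]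
  have h := norm_setIntegral_le_of_norm_le_const (μ := (volume : Measure (Fin d → ℝ)))
    (s := Icc (fun _ => (-1:ℝ)) (fun _ => 1)) (f := akF d x 1) (C := (d:ℝ)^2)
    (isCompact_Icc.measure_lt_top) (fun p _ => by
      rw [Real.norm_of_nonneg (ak_F_nonneg _ _ _ _)]
      simpa using ak_F_le d x 1 zero_le_one hx p)
  refine (le_abs_self _).trans (h.trans (le_of_eq ?_))
  rw [measureReal_def, Real.volume_Icc_pi_toReal (fun _ => by norm_num)]
  simp only [sub_neg_eq_add, Finset.prod_const, Finset.card_univ, Fintype.card_fin]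
  norm_num
  ring

lemma ak_rho_meas (d : ℕ) : Measurable (rho d) := by
  have : rho d = fun x => ∫ p, akF d x 1 p := funext fun x => ak_rho_eq d x
  rw [this]
  have h := (ak_F_meas d 1).stronglyMeasurable
  exact (StronglyMeasurable.integral_prod_right (f := fun x p => akF d x 1 p) h).measurable

lemma ak_rho_int (d : ℕ) (I : Set ℝ) (hI : I ⊆ Icc 0 1) (hm : MeasurableSet I) :
    IntegrableOn (rho d) I := by
  have : IntegrableOn (rho d) (Icc 0 1) := by
    refine Measure.integrableOn_of_bounded (M := 2 ^ d * (d:ℝ) ^ 2) (by simp)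
      (ak_rho_meas d).aestronglyMeasurable ?_
    rw [ae_restrict_iff' measurableSet_Icc]
    refine Filter.Eventually.of_forall fun x hx => ?_
    rw [Real.norm_of_nonneg (ak_rho_nonneg d x)]
    exact ak_rho_le d x hx
  exact this.mono_set hI

lemma ak_rho_pos (d : ℕ) (hd : 2 ≤ d) : ∃ v : ℝ, 0 < v ∧ ∀ x ∈ Icc (0:ℝ) 1, v ≤ rho d x := by
  obtain ⟨e, rfl⟩ : ∃ e, d = e + 1 := ⟨d - 1, by omega⟩
  set a : Fin (e+1) → ℝ := Fin.cons (1/2) (fun _ => 0)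
  set b : Fin (e+1) → ℝ := Fin.cons (3/4) (fun _ => 1 / (4 * ((e:ℝ)+1)))
  have hab : ∀ k, a k < b k := by
    intro k
    refine Fin.cases ?_ (fun j => ?_) k
    · simp only [a, b, Fin.cons_zero]; norm_num
    · simp only [a, b, Fin.cons_succ]; positivity
  refine ⟨1/2 * (volume (Icc a b)).toReal, ?_, ?_⟩
  · rw [Real.volume_Icc_pi_toReal (fun k => (hab k).le)]
    have : 0 < ∏ i, (b i - a i) := Finset.prod_pos fun k _ => sub_pos.2 (hab k)
    positivity
  · intro x hx
    rw [ak_rho_eq]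
    have hle : ∀ p, (Icc a b).indicator (fun _ => (1/2:ℝ)) p ≤ akF (e+1) x 1 p := by
      intro p
      by_cases hp : p ∈ Icc a b
      swap
      · rw [Set.indicator_of_notMem hp]; exact ak_F_nonneg _ _ _ _
      rw [Set.indicator_of_mem hp]
      have p0 : 1/2 ≤ p 0 ∧ p 0 ≤ 3/4 := by
        have h1 := hp.1 0
        have h2 := hp.2 0
        simp only [a, b, Fin.cons_zero] at h1 h2
        exact ⟨h1, h2⟩
      have pj : ∀ j : Fin e, 0 ≤ p j.succ ∧ p j.succ ≤ 1 / (4 * ((e:ℝ)+1)) := by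
        intro j
        have h1 := hp.1 j.succ
        have h2 := hp.2 j.succ
        simp only [a, b, Fin.cons_succ] at h1 h2
        exact ⟨h1, h2⟩
      have hsm : 1 / (4 * ((e:ℝ)+1)) ≤ 1/4 := by
        rw [div_le_div_iff₀ (by positivity) (by norm_num)]
        have : (0:ℝ) ≤ e := by positivity
        linarith
      have hnn : ∀ k, 0 ≤ p k ∧ p k ≤ 1 := by
        intro k
        refine Fin.cases ?_ (fun j => ?_) k
        · constructor <;> linarith [p0.1, p0.2]
        · exact ⟨(pj j).1, by linarith [(pj j).2]⟩
      have hL : |akL (e+1) x p| ≤ 1 := by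
        rw [abs_of_nonneg]
        · unfold akL
          rw [Fin.sum_univ_succ]
          have h1 : ∑ j : Fin e, p j.succ * x ^ (((j.succ : Fin (e+1)) : ℕ) + 1) ≤
              ∑ j : Fin e, 1 / (4 * ((e:ℝ)+1)) := by
            refine Finset.sum_le_sum fun j _ => ?_
            have := pow_le_one₀ (n := ((j.succ : Fin (e+1)) : ℕ) + 1) hx.1 hx.2
            have h0 := pow_nonneg hx.1 (((j.succ : Fin (e+1)) : ℕ) + 1)
            nlinarith [(pj j).1, (pj j).2]
          have h2 : ∑ j : Fin e, 1 / (4 * ((e:ℝ)+1)) ≤ 1/4 := by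
            simp only [Finset.sum_const, Finset.card_univ, Fintype.card_fin, nsmul_eq_mul]
            rw [mul_one_div, div_le_div_iff₀ (by positivity) (by norm_num)]
            linarith
          have h3 : p 0 * x ^ (((0 : Fin (e+1)) : ℕ) + 1) ≤ 3/4 := by
            simp only [Fin.val_zero, zero_add, pow_one]
            nlinarith [p0.1, p0.2, hx.1, hx.2]
          linarith
        · exact Finset.sum_nonneg fun k _ => mul_nonneg (hnn k).1 (pow_nonneg hx.1 _)
      have hDn : 1/2 ≤ akD (e+1) x p := by
        unfold akD
        rw [Fin.sum_univ_succ]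
        have h1 : 0 ≤ ∑ j : Fin e, ((((j.succ : Fin (e+1)) : ℕ) : ℝ) + 1) * p j.succ *
            x ^ ((j.succ : Fin (e+1)) : ℕ) :=
          Finset.sum_nonneg fun j _ => mul_nonneg (mul_nonneg (by positivity) (pj j).1)
            (pow_nonneg hx.1 _)
        simp only [Fin.val_zero, pow_zero, Nat.cast_zero]
        linarith [p0.1]
      unfold akF akPhi
      rw [if_pos, if_pos hL]
      · exact hDn.trans (le_abs_self _)
      · intro k; rw [abs_of_nonneg (hnn k).1]; exact (hnn k).2
    have hi : Integrable ((Icc a b).indicator (fun _ => (1/2:ℝ))) := by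
      rw [integrable_indicator_iff measurableSet_Icc]
      exact integrableOn_const (isCompact_Icc.measure_lt_top.ne)
    have := integral_mono hi (ak_F_int (e+1) x 1 zero_le_one hx) hle
    rw [integral_indicator measurableSet_Icc] at this
    simp only [integral_const, smul_eq_mul, measureReal_restrict_apply_univ] at this
    rw [measureReal_def] at this
    linarith

lemma ak_cube_vol (d : ℕ) (p : Fin d → ℤ) : (volume (akCube d p)) = 1 := by
  unfold akCube
  rw [Real.volume_pi_Ico]
  simp

lemma ak_mem_cube {d : ℕ} {p : Fin d → ℤ} {y : Fin d → ℝ} :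
    y ∈ akCube d p ↔ ∀ k, (p k : ℝ) ≤ y k ∧ y k < p k + 1 := by
  simp [akCube, Set.mem_pi]

lemma ak_cube_meas (d : ℕ) (p : Fin d → ℤ) : MeasurableSet (akCube d p) :=
  MeasurableSet.pi countable_univ fun _ _ => measurableSet_Ico

lemma ak_int_split (d H : ℕ) (x : ℝ) (hx : x ∈ Icc (0:ℝ) 1) :
    ∫ y, akF d x H y = ∑ p ∈ akBox d H, ∫ y in akCube d p, akF d x H y := by
  rw [← integral_biUnion_finset]
  · rw [setIntegral_eq_integral_of_forall_compl_eq_zero]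
    intro y hy
    apply ak_F_supp
    intro hc
    apply hy
    simp only [Set.mem_iUnion]
    refine ⟨fun k => ⌊y k⌋, ?_, ?_⟩
    · rw [ak_mem_box]
      intro k
      have h1 : -(H:ℝ) ≤ y k := hc.1 k
      have h2 : y k ≤ H := hc.2 k
      rw [abs_le]
      constructor
      · rw [Int.le_floor]; push_cast; exact h1
      · have : (⌊y k⌋ : ℝ) ≤ (H:ℤ) := (Int.floor_le _).trans (by push_cast; exact h2)
        exact_mod_cast this
    · rw [ak_mem_cube]
      exact fun k => ⟨Int.floor_le _, Int.lt_floor_add_one _⟩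
  · intro p _; exact ak_cube_meas d p
  · intro p _ q _ hpq
    rw [Function.onFun, Set.disjoint_left]
    intro y hy hy'
    apply hpq
    rw [ak_mem_cube] at hy hy'
    ext k
    have e1 := Int.floor_eq_iff.2 (hy k)
    have e2 := Int.floor_eq_iff.2 (hy' k)
    rw [← e1, e2]
  · intro p _
    exact (ak_F_int d x H (by positivity) hx).integrableOn

def akNear (d H : ℕ) (x : ℝ) (p : Fin d → ℤ) : Prop :=
  0 < x ∧ |(|akL d x (fun k => (p k : ℝ))| - H)| ≤ d * x

def akEdge (d H : ℕ) (p : Fin d → ℤ) : Prop := ∃ k, p k = H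

open Classical in
lemma ak_cell (d H : ℕ) (x : ℝ) (hx : x ∈ Icc (0:ℝ) 1) (p : Fin d → ℤ)
    (hp : p ∈ akBox d H) :
    |akPhi d x H (fun k => (p k : ℝ)) - ∫ y in akCube d p, akF d x H y| ≤
      (d:ℝ)^2 + (d:ℝ)^2 * H * ((if akEdge d H p then 1 else 0) + (if akNear d H x p then 1 else 0)) := by
  set c := akPhi d x H (fun k => (p k : ℝ)) with hc
  set B := (d:ℝ)^2 + (d:ℝ)^2 * H * ((if akEdge d H p then 1 else 0) + (if akNear d H x p then 1 else 0))
  have hpb : ∀ k, |(p k : ℝ)| ≤ H := by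
    intro k
    have := ak_mem_box.1 hp k
    exact_mod_cast this
  have hcF : c = akF d x H (fun k => (p k : ℝ)) := by
    unfold akF; rw [if_pos hpb]
  have hc0 : 0 ≤ c := hcF ▸ ak_F_nonneg _ _ _ _
  have hc1 : c ≤ (d:ℝ)^2 * H := hcF ▸ ak_F_le d x H (by positivity) hx _
  have key : ∀ y ∈ akCube d p, ‖c - akF d x H y‖ ≤ B := by
    intro y hy
    rw [ak_mem_cube] at hy
    have hF0 := ak_F_nonneg d x H y
    have hF1 := ak_F_le d x H (by positivity) hx y
    have hdH : 0 ≤ (d:ℝ)^2 * H := by positivity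
    have hd2 : 0 ≤ (d:ℝ)^2 := by positivity
    have triv : ‖c - akF d x H y‖ ≤ (d:ℝ)^2 * H := by
      rw [Real.norm_eq_abs, abs_le]; constructor <;> linarith
    by_cases he : akEdge d H p
    · refine triv.trans ?_
      simp only [B, if_pos he]
      split_ifs <;> nlinarith
    by_cases hn : akNear d H x p
    · refine triv.trans ?_
      simp only [B, if_pos hn]
      split_ifs <;> nlinarith
    simp only [B, if_neg he, if_neg hn, add_zero, mul_zero]
    have hyb : ∀ k, |y k| ≤ H := by
      intro k
      have h1 : p k ≠ H := fun h => he ⟨k, h⟩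
      have h2 := ak_mem_box.1 hp k
      rw [abs_le] at h2
      have h3 : p k + 1 ≤ H := by omega
      have h3' : (p k : ℝ) + 1 ≤ H := by exact_mod_cast h3
      have h4 : -(H:ℝ) ≤ p k := by exact_mod_cast h2.1
      rw [abs_le]
      constructor
      · linarith [(hy k).1]
      · linarith [(hy k).2]
    have hdiff : ∀ k, |((fun k => (p k : ℝ)) - y) k| ≤ 1 := by
      intro k
      simp only [Pi.sub_apply]
      rw [abs_le]; constructor <;> linarith [(hy k).1, (hy k).2]
    have hD := ak_D_le d x hx _ 1 zero_le_one hdiff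
    have hL := ak_L_le d x hx _ 1 zero_le_one hdiff
    rw [← ak_D_sub, mul_one] at hD
    rw [← ak_L_sub, mul_one] at hL
    have hiff : |akL d x (fun k => (p k : ℝ))| ≤ H ↔ |akL d x y| ≤ H := by
      rcases hx.1.eq_or_lt with h0 | h0
      · rw [← h0, mul_zero] at hL
        have : akL d x (fun k => (p k : ℝ)) = akL d x y := by
          rw [← h0]
          exact sub_eq_zero.1 (abs_nonpos_iff.1 hL)
        rw [this]
      · have hn' : d * x < |(|akL d x (fun k => (p k : ℝ))| - H)| := by
          by_contra hcon
          exact hn ⟨h0, not_lt.1 hcon⟩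
        have h5 := (abs_abs_sub_abs_le_abs_sub (akL d x (fun k => (p k : ℝ))) (akL d x y)).trans hL
        rw [abs_le] at h5
        rcases lt_abs.1 hn' with h | h
        · constructor
          · intro h'; have : 0 ≤ d * x := by positivity
            linarith
          · intro h'; linarith [h5.2]
        · constructor
          · intro h'; linarith [h5.1]
          · intro h'; have : 0 ≤ d * x := by positivity
            linarith
    rw [hc]
    unfold akF akPhi
    rw [if_pos hyb]
    by_cases hl : |akL d x y| ≤ H
    · rw [if_pos hl, if_pos (hiff.2 hl), Real.norm_eq_abs]
      exact (abs_abs_sub_abs_le_abs_sub _ _).trans hD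
    · rw [if_neg hl, if_neg (fun h => hl (hiff.1 h))]
      simpa using hd2
  have hvt : volume (akCube d p) < ⊤ := by rw [ak_cube_vol]; simp
  have hi : IntegrableOn (akF d x H) (akCube d p) :=
    (ak_F_int d x H (by positivity) hx).integrableOn
  have e : c - ∫ y in akCube d p, akF d x H y = ∫ y in akCube d p, (c - akF d x H y) := by
    have hcc : IntegrableOn (fun _ : Fin d → ℝ => c) (akCube d p) := integrableOn_const hvt.ne
    rw [integral_sub hcc hi]
    simp [measureReal_def, ak_cube_vol]
  rw [e]
  have := norm_setIntegral_le_of_norm_le_const hvt key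
  simpa [measureReal_def, ak_cube_vol] using this

lemma ak_pow_sub (a b : ℕ) (h : b ≤ a) (n : ℕ) : a ^ (n+1) - b ^ (n+1) ≤ (n+1) * (a - b) * a ^ n := by
  have := abs_pow_sub_pow_le (a:ℤ) b (n+1)
  have h2 : b ^ (n+1) ≤ a ^ (n+1) := Nat.pow_le_pow_left h _
  zify [h, h2]
  rw [abs_of_nonneg (by exact_mod_cast (by zify at h h2 ⊢; linarith))] at this
  rw [abs_of_nonneg (by zify at h; linarith : (0:ℤ) ≤ a - b), Nat.abs_cast, Nat.abs_cast, max_eq_left (by exact_mod_cast h)] at this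
  simp only [Nat.add_sub_cancel] at this
  push_cast at this
  linarith

open Classical in
lemma ak_edge_card (e H : ℕ) : ((akBox (e+1) H).filter (akEdge (e+1) H)).card ≤ (e+1) * (2*H+1)^e := by
  set S : Finset (Fin (e+1) → ℤ) := Fintype.piFinset (fun _ => Finset.Ico (-(H:ℤ)) H)
  have hS : S ⊆ akBox (e+1) H := by
    intro v hv
    rw [ak_mem_box]
    intro k
    have := Fintype.mem_piFinset.1 hv k
    rw [Finset.mem_Ico] at this
    rw [abs_le]; omega
  have hsub : (akBox (e+1) H).filter (akEdge (e+1) H) ⊆ akBox (e+1) H \ S := by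
    intro v hv
    rw [Finset.mem_filter] at hv
    rw [Finset.mem_sdiff]
    refine ⟨hv.1, fun h => ?_⟩
    obtain ⟨k, hk⟩ := hv.2
    have := Fintype.mem_piFinset.1 h k
    rw [Finset.mem_Ico] at this
    omega
  have hcS : S.card = (2*H)^(e+1) := by
    simp only [S, Fintype.card_piFinset, Int.card_Ico, Finset.prod_const, Finset.card_univ,
      Fintype.card_fin]
    congr 1; omega
  refine (Finset.card_le_card hsub).trans ?_
  rw [Finset.card_sdiff_of_subset hS, ak_card_box, hcS]
  have := ak_pow_sub (2*H+1) (2*H) (by omega) e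
  simpa using this

lemma ak_int_interval (c r : ℝ) (hr : 0 ≤ r) (S : Finset ℤ) (hS : ∀ m ∈ S, |(m:ℝ) - c| ≤ r) :
    (S.card : ℝ) ≤ 2 * r + 1 := by
  have h1 : S ⊆ Finset.Icc ⌈c - r⌉ ⌊c + r⌋ := by
    intro m hm
    have := abs_le.1 (hS m hm)
    rw [Finset.mem_Icc, Int.ceil_le, Int.le_floor]
    constructor <;> linarith
  have h2 := Finset.card_le_card h1
  rw [Int.card_Icc] at h2
  have f2 := Int.le_ceil (c - r)
  have g3 := Int.floor_le (c + r)
  rcases le_or_gt (⌊c+r⌋ + 1 - ⌈c-r⌉) 0 with h | h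
  · have : S.card = 0 := by omega
    rw [this]; push_cast; linarith
  · have : (S.card : ℤ) ≤ ⌊c+r⌋ + 1 - ⌈c-r⌉ := by omega
    have : (S.card : ℝ) ≤ (⌊c+r⌋ : ℝ) + 1 - ⌈c-r⌉ := by exact_mod_cast this
    linarith

open Classical in
lemma ak_near_card (e H : ℕ) (x : ℝ) :
    ((akBox (e+1) H).filter (akNear (e+1) H x)).card ≤ (2 * (2*(e+1)+1)) * (2*H+1)^e := by
  rw [← ak_card_box]
  refine Finset.card_le_mul_card_image_of_maps_to (f := Fin.tail) ?_ _ ?_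
  · intro v hv
    rw [Finset.mem_filter, ak_mem_box] at hv
    rw [ak_mem_box]
    intro k; exact hv.1 k.succ
  · intro t _
    set T := ((akBox (e+1) H).filter (akNear (e+1) H x)).filter (fun a => Fin.tail a = t)
    have hT : T.card = (T.image (fun v => v 0)).card := by
      rw [Finset.card_image_of_injOn]
      intro v hv w hw h
      simp only [T, Finset.coe_filter, Set.mem_ofPred_eq] at hv hw
      rw [← Fin.cons_self_tail v, ← Fin.cons_self_tail w, hv.2, hw.2]
      simp only at h
      rw [h]
    by_cases hx : 0 < x
    swap
    · have : T = ∅ := by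
        ext v
        simp only [T, Finset.mem_filter, Finset.notMem_empty, iff_false]
        rintro ⟨⟨_, h, _⟩, _⟩
        exact hx h
      rw [this]; simp
    set r := ∑ j : Fin e, (t j : ℝ) * x ^ ((j:ℕ) + 1)
    have hL : ∀ v ∈ T, akL (e+1) x (fun k => (v k : ℝ)) = x * ((v 0 : ℝ) + r) := by
      intro v hv
      simp only [T, Finset.mem_filter] at hv
      unfold akL
      rw [Fin.sum_univ_succ, mul_add, Finset.mul_sum]
      congr 1
      · simp; ring
      · refine Finset.sum_congr rfl fun j _ => ?_
        rw [← hv.2]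
        simp only [Fin.tail, Fin.val_succ]
        ring
    set S := T.image (fun v => v 0)
    have hsub : ∀ m ∈ S, |(m:ℝ) - (H / x - r)| ≤ (e+1:ℝ) ∨ |(m:ℝ) - (-(H / x) - r)| ≤ (e+1:ℝ) := by
      intro m hm
      simp only [S, Finset.mem_image] at hm
      obtain ⟨v, hv, rfl⟩ := hm
      have hl := hL v hv
      simp only [T, Finset.mem_filter] at hv
      have hn := hv.1.2.2
      rw [hl] at hn
      have hHx : (H:ℝ) = x * (H / x) := by field_simp
      rcases abs_cases (x * ((v 0 : ℝ) + r)) with ⟨h1, _⟩ | ⟨h1, _⟩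
      · left
        rw [h1, hHx, ← mul_sub, abs_mul, abs_of_pos hx] at hn
        push_cast at hn
        have : |(v 0:ℝ) + r - H / x| ≤ e + 1 := by nlinarith
        rw [show (v 0:ℝ) - (H / x - r) = (v 0:ℝ) + r - H / x by ring]
        exact this
      · right
        rw [h1, hHx, show -(x * ((v 0:ℝ) + r)) - x * (H/x) = x * (-((v 0:ℝ) - (-(H / x) - r))) by ring,
          abs_mul, abs_of_pos hx, abs_neg] at hn
        push_cast at hn
        nlinarith
    have hS : S ⊆ S.filter (fun m : ℤ => |(m:ℝ) - (H / x - r)| ≤ (e+1:ℝ)) ∪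
        S.filter (fun m : ℤ => |(m:ℝ) - (-(H / x) - r)| ≤ (e+1:ℝ)) := by
      intro m hm
      rw [Finset.mem_union, Finset.mem_filter, Finset.mem_filter]
      rcases hsub m hm with h | h
      · exact Or.inl ⟨hm, h⟩
      · exact Or.inr ⟨hm, h⟩
    have c0 := (Finset.card_le_card hS).trans (Finset.card_union_le _ _)
    have c1 := ak_int_interval (H / x - r) (e+1) (by positivity)
      (S.filter (fun m : ℤ => |(m:ℝ) - (H / x - r)| ≤ (e+1:ℝ))) (fun m hm => (Finset.mem_filter.1 hm).2)
    have c2 := ak_int_interval (-(H / x) - r) (e+1) (by positivity)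
      (S.filter (fun m : ℤ => |(m:ℝ) - (-(H / x) - r)| ≤ (e+1:ℝ))) (fun m hm => (Finset.mem_filter.1 hm).2)
    rw [hT]
    have c1' : (S.filter (fun m : ℤ => |(m:ℝ) - (H / x - r)| ≤ (e+1:ℝ))).card ≤ 2 * (e+1) + 1 := by
      exact_mod_cast c1
    have c2' : (S.filter (fun m : ℤ => |(m:ℝ) - (-(H / x) - r)| ≤ (e+1:ℝ))).card ≤ 2 * (e+1) + 1 := by
      exact_mod_cast c2
    omega

lemma ak_sum_phi (d H : ℕ) (hd : 1 ≤ d) (hH : 1 ≤ H) (x : ℝ) (hx : x ∈ Icc (0:ℝ) 1) :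
    |(∑ p ∈ akBox d H, akPhi d x H (fun k => (p k : ℝ))) - (H:ℝ)^(d+1) * rho d x| ≤
      8 * (d:ℝ)^3 * 3^d * (H:ℝ)^d := by
  classical
  rw [ak_rho_scale d x H (by exact_mod_cast hH), ak_int_split d H x hx, ← Finset.sum_sub_distrib]
  refine (Finset.abs_sum_le_sum_abs _ _).trans ((Finset.sum_le_sum fun p hp =>
    ak_cell d H x hx p hp).trans ?_)
  rw [Finset.sum_add_distrib, ← Finset.mul_sum, Finset.sum_add_distrib, Finset.sum_boole,
    Finset.sum_boole, Finset.sum_const, ak_card_box]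
  obtain ⟨e, rfl⟩ : ∃ e, d = e + 1 := ⟨d - 1, by omega⟩
  have h1 : (((akBox (e+1) H).filter (akEdge (e+1) H)).card : ℝ) ≤ (e+1) * (2*H+1)^e := by
    exact_mod_cast ak_edge_card e H
  have h2 : (((akBox (e+1) H).filter (akNear (e+1) H x)).card : ℝ) ≤ (2 * (2*(e+1)+1)) * (2*H+1)^e := by
    exact_mod_cast ak_near_card e H x
  have hH' : (1:ℝ) ≤ H := by exact_mod_cast hH
  have h3 : ((2:ℝ)*H+1)^e ≤ 3^e * (H:ℝ)^e := by
    rw [← mul_pow]; gcongr; linarith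
  have h4 : ((2:ℝ)*H+1)^(e+1) ≤ 3^(e+1) * (H:ℝ)^(e+1) := by
    rw [← mul_pow]; gcongr; linarith
  set E : ℝ := 3^e * (H:ℝ)^e with hE
  have hE0 : 0 ≤ E := by positivity
  simp only [nsmul_eq_mul]
  push_cast
  have he : (0:ℝ) ≤ e := by positivity
  calc (2*(H:ℝ)+1)^(e+1) * ((e:ℝ)+1)^2 + ((e:ℝ)+1)^2 * H *
        ((((akBox (e+1) H).filter (akEdge (e+1) H)).card : ℝ) +
          (((akBox (e+1) H).filter (akNear (e+1) H x)).card : ℝ))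
      ≤ (3^(e+1) * (H:ℝ)^(e+1)) * ((e:ℝ)+1)^2 + ((e:ℝ)+1)^2 * H *
        ((e+1) * E + (2 * (2*(e+1)+1)) * E) := by
        gcongr
        · exact h1.trans (by gcongr)
        · exact h2.trans (by gcongr)
    _ = ((e:ℝ)+1)^2 * H * E * (3 + (5 * (e+1) + 2)) := by rw [hE]; ring
    _ ≤ ((e:ℝ)+1)^2 * H * E * (24 * (e+1)) := by gcongr; linarith
    _ = 8 * ((e:ℝ)+1)^3 * 3^(e+1) * (H:ℝ)^(e+1) := by rw [hE]; ring

def akPoly {n : ℕ} (v : Fin n → ℤ) : Polynomial ℤ := ∑ i : Fin n, Polynomial.monomial (i:ℕ) (v i)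

def akN (I : Set ℝ) (P : Polynomial ℤ) : ℕ := Set.ncard (P.rootSet ℝ ∩ I)

lemma ak_coeff {n : ℕ} (v : Fin n → ℤ) (k : ℕ) :
    (akPoly v).coeff k = if h : k < n then v ⟨k, h⟩ else 0 := by
  unfold akPoly
  rw [Polynomial.finsetSum_coeff]
  simp only [Polynomial.coeff_monomial]
  split_ifs with h
  · rw [Finset.sum_eq_single ⟨k, h⟩]
    · simp
    · intro b _ hb
      rw [if_neg]
      intro h'; exact hb (Fin.ext h')
    · simp
  · refine Finset.sum_eq_zero fun i _ => ?_
    rw [if_neg]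
    intro h'; exact h (h' ▸ i.2)

lemma ak_poly_inj {n : ℕ} : Function.Injective (akPoly (n := n)) := by
  intro v w h
  ext k
  have := congrArg (fun P => Polynomial.coeff P (k:ℕ)) h
  simpa [ak_coeff] using this

lemma ak_poly_zero {n : ℕ} : akPoly (0 : Fin n → ℤ) = 0 := by
  simp [akPoly]

lemma ak_natDegree {n : ℕ} (v : Fin (n+1) → ℤ) : (akPoly v).natDegree ≤ n := by
  rw [Polynomial.natDegree_le_iff_coeff_eq_zero]
  intro N hN
  rw [ak_coeff, dif_neg (by omega)]

lemma ak_N_le (I : Set ℝ) {n : ℕ} (v : Fin (n+1) → ℤ) : akN I (akPoly v) ≤ n :=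
  (Set.ncard_le_ncard Set.inter_subset_left (Polynomial.rootSet_finite _ _)).trans
    ((Polynomial.ncard_rootSet_le _ _).trans (ak_natDegree v))

open Polynomial in
def akRP {d : ℕ} (p : Fin d → ℤ) : ℝ[X] := ∑ k : Fin d, monomial ((k:ℕ)+1) (p k : ℝ)

open Polynomial in
lemma ak_RP_eval {d : ℕ} (p : Fin d → ℤ) (x : ℝ) : (akRP p).eval x = akL d x (fun k => (p k : ℝ)) := by
  simp [akRP, akL, eval_finsetSum]

open Polynomial in
lemma ak_RP_deriv {d : ℕ} (p : Fin d → ℤ) (x : ℝ) :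
    (derivative (akRP p)).eval x = akD d x (fun k => (p k : ℝ)) := by
  simp only [akRP, akD, derivative_sum, eval_finsetSum, derivative_monomial, eval_monomial]
  refine Finset.sum_congr rfl fun k _ => ?_
  push_cast
  ring

open Polynomial in
lemma ak_RP_ne {d : ℕ} (p : Fin d → ℤ) (hp : p ≠ 0) : derivative (akRP p) ≠ 0 := by
  intro h
  apply hp
  ext k
  have := congrArg (fun P => P.coeff (k:ℕ)) h
  simp only [coeff_derivative, akRP, finsetSum_coeff, coeff_monomial, coeff_zero] at this
  rw [Finset.sum_eq_single k] at this
  · simp only [if_true] at this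
    have h2 : ((k:ℕ):ℝ) + 1 ≠ 0 := by positivity
    have h3 := (mul_eq_zero.1 this).resolve_right h2
    exact_mod_cast h3
  · intro b _ hb
    rw [if_neg]
    intro h'; exact hb (Fin.ext (by omega))
  · simp

open Polynomial in
lemma ak_RP_deg {d : ℕ} (p : Fin d → ℤ) : (derivative (akRP p)).natDegree ≤ d := by
  refine (natDegree_derivative_le _).trans ?_
  refine (Nat.sub_le _ _).trans ?_
  refine natDegree_sum_le_of_forall_le _ _ fun k _ => ?_
  refine (natDegree_monomial_le _).trans ?_
  omega

lemma ak_aeval_cons {d : ℕ} (m : ℤ) (p : Fin d → ℤ) (x : ℝ) :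
    Polynomial.aeval x (akPoly (Fin.cons m p : Fin (d+1) → ℤ)) = m + akL d x (fun k => (p k : ℝ)) := by
  unfold akPoly akL
  rw [Fin.sum_univ_succ, map_add, map_sum]
  congr 1
  · simp
  · refine Finset.sum_congr rfl fun k _ => ?_
    simp [Polynomial.aeval_monomial]

open Polynomial in
lemma ak_fiber_count (d H : ℕ) (I : Set ℝ) (hI : I ⊆ Icc 0 1) (hc : I.OrdConnected)
    (p : Fin d → ℤ) :
    |(∑ m ∈ Finset.Icc (-(H:ℤ)) H, (akN I (akPoly (Fin.cons m p : Fin (d+1) → ℤ)) : ℝ)) -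
      ∫ x in I, akPhi d x H (fun k => (p k : ℝ))| ≤ 2 * d + 1 := by
  by_cases hp : p = 0
  · subst hp
    have e1 : ∀ m : ℤ, akN I (akPoly (Fin.cons m 0 : Fin (d+1) → ℤ)) = 0 := by
      intro m
      have : akPoly (Fin.cons m 0 : Fin (d+1) → ℤ) = C m := by
        unfold akPoly
        rw [Fin.sum_univ_succ]
        simp
      rw [akN, this, rootSet_C]
      simp
    have e2 : ∀ x, akPhi d x H (fun k => (((0 : Fin d → ℤ) k : ℤ) : ℝ)) = 0 := by
      intro x
      unfold akPhi akD
      simp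
    simp only [e1, e2]
    simp
    positivity
  · have hne := ak_RP_ne p hp
    have h := ak_indicatrix (akRP p) hne H _ I hI hc le_rfl
    have hcard : Set.ncard {x ∈ I | (derivative (akRP p)).eval x = 0} ≤ d := by
      have h1 : Set.ncard {x ∈ I | (derivative (akRP p)).eval x = 0} ≤
          Set.ncard ((derivative (akRP p)).rootSet ℝ) := by
        refine Set.ncard_le_ncard ?_ (rootSet_finite _ _)
        rintro x ⟨_, hx⟩
        rw [mem_rootSet]
        exact ⟨hne, by simpa using hx⟩
      exact h1.trans ((ncard_rootSet_le _ _).trans (ak_RP_deg p))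
    have e1 : (∑ m ∈ Finset.Icc (-(H:ℤ)) H, (akN I (akPoly (Fin.cons m p : Fin (d+1) → ℤ)) : ℝ)) =
        (∑ m ∈ Finset.Icc (-(H:ℤ)) H, (Set.ncard {x ∈ I | (akRP p).eval x = (m:ℝ)} : ℝ)) := by
      refine Finset.sum_equiv (Equiv.neg ℤ) ?_ ?_
      · intro m; simp only [Finset.mem_Icc, Equiv.neg_apply]; omega
      · intro m _
        congr 1
        unfold akN
        congr 1
        ext x
        simp only [Set.mem_inter_iff, mem_rootSet, ak_aeval_cons, Set.mem_ofPred_eq, ak_RP_eval,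
          Equiv.neg_apply]
        push_cast
        have hP : akPoly (Fin.cons m p : Fin (d+1) → ℤ) ≠ 0 := by
          intro h0
          rw [← ak_poly_zero (n := d+1)] at h0
          have := ak_poly_inj h0
          apply hp
          ext k
          have := congrFun this k.succ
          simpa using this
        constructor
        · rintro ⟨⟨_, h1⟩, h2⟩
          exact ⟨h2, by linarith⟩
        · rintro ⟨h2, h1⟩
          exact ⟨⟨hP, by linarith⟩, h2⟩
    have e2 : ∫ x in I, akPhi d x H (fun k => (p k : ℝ)) =
        ∫ x in I, (if |(akRP p).eval x| ≤ (H:ℝ) then |(derivative (akRP p)).eval x| else 0) := by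
      simp only [akPhi, ak_RP_eval, ak_RP_deriv]
    rw [e1, e2]
    refine h.trans ?_
    have : (Set.ncard {x ∈ I | (derivative (akRP p)).eval x = 0} : ℝ) ≤ d := by exact_mod_cast hcard
    linarith

lemma ak_phi_int (d H : ℕ) (I : Set ℝ) (hI : I ⊆ Icc 0 1) (hm : MeasurableSet I)
    (p : Fin d → ℤ) : IntegrableOn (fun x => akPhi d x H (fun k => (p k : ℝ))) I := by
  have := ak_integrand_int (akRP p) I hI hm H
  simpa only [akPhi, ak_RP_eval, ak_RP_deriv] using this

def akA (I : Set ℝ) (d H : ℕ) : ℝ := ∑ v ∈ akBox (d+1) H, (akN I (akPoly v) : ℝ)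

lemma ak_A_split (I : Set ℝ) (d H : ℕ) : akA I d H = ∑ p ∈ akBox d H,
    ∑ m ∈ Finset.Icc (-(H:ℤ)) H, (akN I (akPoly (Fin.cons m p : Fin (d+1) → ℤ)) : ℝ) := by
  unfold akA
  rw [← Finset.sum_product' (akBox d H) (Finset.Icc (-(H:ℤ)) H)
    (fun p m => (akN I (akPoly (Fin.cons m p : Fin (d+1) → ℤ)) : ℝ))]
  refine Finset.sum_nbij' (fun v => (Fin.tail v, v 0))
    (fun z => (Fin.cons z.2 z.1 : Fin (d+1) → ℤ)) ?_ ?_ ?_ ?_ ?_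
  · intro v hv
    rw [ak_mem_box] at hv
    rw [Finset.mem_product, ak_mem_box, Finset.mem_Icc]
    exact ⟨fun k => hv k.succ, abs_le.1 (hv 0)⟩
  · intro z hz
    rw [Finset.mem_product, ak_mem_box, Finset.mem_Icc] at hz
    rw [ak_mem_box]
    intro k
    refine Fin.cases ?_ (fun j => ?_) k
    · rw [Fin.cons_zero]; exact abs_le.2 hz.2
    · rw [Fin.cons_succ]; exact hz.1 j
  · intro v _; exact Fin.cons_self_tail v
  · intro z _; simp
  · intro v _; simp

lemma ak_vol_le (I : Set ℝ) (hI : I ⊆ Icc 0 1) : volume.real I ≤ 1 := by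
  have : volume.real I ≤ volume.real (Icc (0:ℝ) 1) := measureReal_mono hI (by simp)
  simpa using this

lemma ak_A_asymp (d H : ℕ) (hd : 1 ≤ d) (hH : 1 ≤ H) (I : Set ℝ) (hI : I ⊆ Icc 0 1)
    (hc : I.OrdConnected) :
    |akA I d H - (H:ℝ)^(d+1) * ∫ x in I, rho d x| ≤ 11 * (d:ℝ)^3 * 3^d * (H:ℝ)^d := by
  have hm := hc.measurableSet
  have h1 : |akA I d H - ∑ p ∈ akBox d H, ∫ x in I, akPhi d x H (fun k => (p k : ℝ))| ≤
      (2*H+1)^d * (2 * d + 1) := by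
    rw [ak_A_split, ← Finset.sum_sub_distrib]
    refine (Finset.abs_sum_le_sum_abs _ _).trans ((Finset.sum_le_sum fun p _ =>
      ak_fiber_count d H I hI hc p).trans ?_)
    rw [Finset.sum_const, ak_card_box, nsmul_eq_mul]
    push_cast
    rfl
  have hvt : volume I < ⊤ := (measure_mono hI).trans_lt (by simp)
  have h2 : |(∑ p ∈ akBox d H, ∫ x in I, akPhi d x H (fun k => (p k : ℝ))) -
      (H:ℝ)^(d+1) * ∫ x in I, rho d x| ≤ 8 * (d:ℝ)^3 * 3^d * (H:ℝ)^d := by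
    rw [← integral_finsetSum _ (fun p _ => ak_phi_int d H I hI hm p), ← integral_const_mul,
      ← integral_sub (integrable_finsetSum _ (fun p _ => ak_phi_int d H I hI hm p))
        ((ak_rho_int d I hI hm).const_mul _)]
    have := norm_setIntegral_le_of_norm_le_const (μ := volume) (s := I)
      (f := fun x => (∑ p ∈ akBox d H, akPhi d x H (fun k => (p k : ℝ))) - (H:ℝ)^(d+1) * rho d x)
      hvt (fun x hx => ak_sum_phi d H hd hH x (hI hx))
    refine this.trans ?_
    have h3 := ak_vol_le I hI
    have h4 : 0 ≤ 8 * (d:ℝ)^3 * 3^d * (H:ℝ)^d := by positivity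
    nlinarith
  have hH' : (1:ℝ) ≤ H := by exact_mod_cast hH
  have hd' : (1:ℝ) ≤ d := by exact_mod_cast hd
  have h3 : ((2:ℝ)*H+1)^d * (2 * d + 1) ≤ 3 * (d:ℝ)^3 * 3^d * (H:ℝ)^d := by
    have : ((2:ℝ)*H+1)^d ≤ 3^d * (H:ℝ)^d := by
      rw [← mul_pow]; gcongr; linarith
    have h5 : 2 * (d:ℝ) + 1 ≤ 3 * (d:ℝ)^3 := by nlinarith [sq_nonneg ((d:ℝ) - 1)]
    calc ((2:ℝ)*H+1)^d * (2 * d + 1) ≤ (3^d * (H:ℝ)^d) * (3 * (d:ℝ)^3) := by gcongr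
      _ = _ := by ring
  have := abs_sub_le (akA I d H) (∑ p ∈ akBox d H, ∫ x in I, akPhi d x H (fun k => (p k : ℝ)))
    ((H:ℝ)^(d+1) * ∫ x in I, rho d x)
  linarith

def akG {n : ℕ} (v : Fin n → ℤ) : ℕ := Finset.univ.gcd (fun i => (v i).natAbs)

lemma ak_dvd_G {n : ℕ} (v : Fin n → ℤ) (k : ℕ) : k ∣ akG v ↔ ∀ i, (k:ℤ) ∣ v i := by
  unfold akG
  rw [Finset.dvd_gcd_iff]
  simp only [Finset.mem_univ, true_implies, Int.natCast_dvd]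

lemma ak_N_zero (I : Set ℝ) {n : ℕ} : akN I (akPoly (0 : Fin n → ℤ)) = 0 := by
  rw [ak_poly_zero, akN]; simp

lemma ak_N_smul (I : Set ℝ) {n : ℕ} (k : ℕ) (hk : 1 ≤ k) (v : Fin n → ℤ) :
    akN I (akPoly (fun i => (k:ℤ) * v i)) = akN I (akPoly v) := by
  have e : akPoly (fun i => (k:ℤ) * v i) = Polynomial.C (k:ℤ) * akPoly v := by
    unfold akPoly
    rw [Finset.mul_sum]
    refine Finset.sum_congr rfl fun i _ => ?_
    rw [Polynomial.C_mul_monomial]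
  unfold akN
  congr 2
  ext x
  rw [Polynomial.mem_rootSet, Polynomial.mem_rootSet, e]
  have hk' : (k:ℤ) ≠ 0 := by omega
  have hk'' : (k:ℝ) ≠ 0 := by positivity
  simp [hk', hk'']
  omega

lemma ak_sum_mu (g H : ℕ) (hg : 1 ≤ g) (hgH : g ≤ H) :
    (∑ n ∈ (Finset.Icc 1 H).filter (fun n => n ∣ g), (ArithmeticFunction.moebius n : ℤ)) =
      if g = 1 then 1 else 0 := by
  have e : (Finset.Icc 1 H).filter (fun n => n ∣ g) = g.divisors := by
    ext n
    simp only [Finset.mem_filter, Finset.mem_Icc, Nat.mem_divisors]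
    constructor
    · rintro ⟨_, h⟩; exact ⟨h, by omega⟩
    · rintro ⟨h, _⟩
      exact ⟨⟨Nat.pos_of_dvd_of_pos h hg, (Nat.le_of_dvd hg h).trans hgH⟩, h⟩
  rw [e, ← ArithmeticFunction.coe_mul_zeta_apply, ArithmeticFunction.moebius_mul_coe_zeta,
    ArithmeticFunction.one_apply]

lemma ak_A_dvd (I : Set ℝ) (d H n : ℕ) (hn : 1 ≤ n) :
    (∑ v ∈ (akBox (d+1) H).filter (fun v => n ∣ akG v), (akN I (akPoly v) : ℝ)) = akA I d (H / n) := by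
  unfold akA
  symm
  have hn' : (0:ℤ) < n := by omega
  refine Finset.sum_nbij' (fun u => fun i => (n:ℤ) * u i) (fun v => fun i => v i / n) ?_ ?_ ?_ ?_ ?_
  · intro u hu
    rw [ak_mem_box] at hu
    rw [Finset.mem_filter, ak_mem_box, ak_dvd_G]
    refine ⟨fun k => ?_, fun i => Dvd.intro _ rfl⟩
    rw [abs_mul, Nat.abs_cast]
    have h1 := hu k
    have h2 : ((n * (H / n) : ℕ) : ℤ) ≤ H := by exact_mod_cast Nat.mul_div_le H n
    push_cast at h2 h1
    nlinarith
  · intro v hv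
    rw [Finset.mem_filter, ak_mem_box, ak_dvd_G] at hv
    rw [ak_mem_box]
    intro k
    obtain ⟨w, hw⟩ := hv.2 k
    have h1 := hv.1 k
    rw [hw, abs_mul, Nat.abs_cast] at h1
    rw [hw, Int.mul_ediv_cancel_left _ hn'.ne']
    push_cast
    rw [Int.le_ediv_iff_mul_le hn']
    linarith
  · intro u _
    ext i
    simp only
    rw [Int.mul_ediv_cancel_left _ hn'.ne']
  · intro v hv
    rw [Finset.mem_filter, ak_dvd_G] at hv
    ext i
    simp only
    rw [Int.mul_ediv_cancel' (hv.2 i)]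
  · intro u _
    rw [ak_N_smul I n hn u]

def akAp (I : Set ℝ) (d H : ℕ) : ℝ :=
  ∑ v ∈ (akBox (d+1) H).filter (fun v => akG v = 1), (akN I (akPoly v) : ℝ)

lemma ak_Ap_eq (I : Set ℝ) (d H : ℕ) : akAp I d H =
    ∑ n ∈ Finset.Icc 1 H, (ArithmeticFunction.moebius n : ℝ) * akA I d (H / n) := by
  have e1 : ∀ n ∈ Finset.Icc 1 H, (ArithmeticFunction.moebius n : ℝ) * akA I d (H / n) =
      ∑ v ∈ akBox (d+1) H, if n ∣ akG v then
        (ArithmeticFunction.moebius n : ℝ) * (akN I (akPoly v) : ℝ) else 0 := by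
    intro n hn
    rw [← ak_A_dvd I d H n (Finset.mem_Icc.1 hn).1, Finset.mul_sum, Finset.sum_filter]
  rw [Finset.sum_congr rfl e1, Finset.sum_comm, akAp, Finset.sum_filter]
  refine Finset.sum_congr rfl fun v hv => ?_
  by_cases hv0 : v = 0
  · subst hv0
    simp [ak_N_zero]
  · obtain ⟨i, hi⟩ : ∃ i, v i ≠ 0 := by
      by_contra h
      push Not at h
      exact hv0 (funext h)
    have hdv := (ak_dvd_G v (akG v)).1 dvd_rfl i
    have hle : akG v ≤ H := by
      have h1 := Int.le_of_dvd (abs_pos.2 hi) ((dvd_abs _ _).2 hdv)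
      have h2 := ak_mem_box.1 hv i
      omega
    have hpos : 1 ≤ akG v := by
      rcases Nat.eq_zero_or_pos (akG v) with h | h
      · rw [h] at hdv
        exact absurd (by simpa using hdv) hi
      · exact h
    have := ak_sum_mu (akG v) H hpos hle
    have h3 : (∑ n ∈ (Finset.Icc 1 H).filter (fun n => n ∣ akG v),
      (ArithmeticFunction.moebius n : ℝ)) = if akG v = 1 then 1 else 0 := by exact_mod_cast this
    rw [← Finset.sum_filter, ← Finset.sum_mul, h3]
    split_ifs <;> simp

lemma ak_sum_inv_sq (H : ℕ) : ∑ n ∈ Finset.Icc 1 H, ((n:ℝ)^2)⁻¹ ≤ 2 := by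
  have h := sum_Ioo_inv_sq_le (α := ℝ) 0 (H+1)
  have e : Finset.Ioo 0 (H+1) = Finset.Icc 1 H := by
    ext n; simp only [Finset.mem_Ioo, Finset.mem_Icc]; omega
  rw [e] at h
  simpa using h

lemma ak_summable (s : ℕ) (hs : 2 ≤ s) : Summable (fun n : ℕ => 1 / ((n:ℝ)+1)^s) := by
  have := (summable_nat_add_iff 1).2 (Real.summable_one_div_nat_pow.2 (by omega : 1 < s))
  simpa using this

lemma ak_zeta_ge (s : ℕ) (hs : 2 ≤ s) : 1 ≤ zetaR s := by
  have := (ak_summable s hs).le_tsum 0 (fun n _ => by positivity)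
  simpa [zetaR] using this

lemma ak_mu_summable (s : ℕ) (hs : 2 ≤ s) :
    Summable (fun n : ℕ => (ArithmeticFunction.moebius n : ℝ) / (n:ℝ)^s) := by
  refine Summable.of_norm_bounded (Real.summable_one_div_nat_pow.2 (by omega : 1 < s)) fun n => ?_
  rw [norm_div, Real.norm_eq_abs, Real.norm_of_nonneg (by positivity)]
  gcongr
  exact_mod_cast ArithmeticFunction.abs_moebius_le_one

lemma ak_mu_zeta (s : ℕ) (hs : 2 ≤ s) :
    zetaR s * ∑' n : ℕ, (ArithmeticFunction.moebius n : ℝ) / (n:ℝ)^s = 1 := by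
  have hs' : 1 < (s:ℂ).re := by simp; omega
  have h := ArithmeticFunction.LSeries_zeta_mul_Lseries_moebius hs'
  rw [ArithmeticFunction.LSeries_zeta_eq_riemannZeta hs', zeta_nat_eq_tsum_of_gt_one (by omega)] at h
  have e1 : (∑' n : ℕ, 1 / (n:ℂ)^s) = ((zetaR s : ℝ) : ℂ) := by
    have h0 : (∑' n : ℕ, 1 / (n:ℝ)^s) = zetaR s := by
      rw [(Real.summable_one_div_nat_pow.2 (by omega : 1 < s)).tsum_eq_zero_add]
      simp [zetaR]
      omega
    rw [← h0]
    push_cast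
    rfl
  have e2 : LSeries (fun n => ((ArithmeticFunction.moebius n : ℤ) : ℂ)) s =
      ((∑' n : ℕ, (ArithmeticFunction.moebius n : ℝ) / (n:ℝ)^s : ℝ) : ℂ) := by
    unfold LSeries
    push_cast
    refine tsum_congr fun n => ?_
    rw [LSeries.term_def]
    split_ifs with hn
    · subst hn; simp
    · simp
  rw [e1] at h
  have h' := h
  erw [e2] at h'
  exact_mod_cast h'

lemma ak_mu_tail (s H : ℕ) (hs : 3 ≤ s) (hH : 1 ≤ H) :
    |(∑ n ∈ Finset.Icc 1 H, (ArithmeticFunction.moebius n : ℝ) / (n:ℝ)^s) - (zetaR s)⁻¹| ≤ 2 / H := by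
  have hz : (zetaR s)⁻¹ = ∑' n : ℕ, (ArithmeticFunction.moebius n : ℝ) / (n:ℝ)^s := by
    have h := ak_mu_zeta s (by omega)
    have h2 := ak_zeta_ge s (by omega)
    field_simp
    linarith
  have hsum := (ak_mu_summable s (by omega)).sum_add_tsum_nat_add (H+1)
  have e : ∑ n ∈ Finset.range (H+1), (ArithmeticFunction.moebius n : ℝ) / (n:ℝ)^s =
      ∑ n ∈ Finset.Icc 1 H, (ArithmeticFunction.moebius n : ℝ) / (n:ℝ)^s := by
    symm
    refine Finset.sum_subset ?_ ?_
    · intro n hn; rw [Finset.mem_Icc] at hn; rw [Finset.mem_range]; omega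
    · intro n hn hn'
      have : n = 0 := by
        rw [Finset.mem_range] at hn; rw [Finset.mem_Icc] at hn'; omega
      subst this; simp
  rw [hz, ← hsum, e, sub_add_cancel_left, abs_neg]
  have hH' : (1:ℝ) ≤ H := by exact_mod_cast hH
  have hbase : HasSum (fun n : ℕ => 1 / ((n:ℝ)+1)^2 / H) (zetaR 2 / H) :=
    ((ak_summable 2 le_rfl).hasSum).div_const _
  have hz2 : zetaR 2 ≤ 2 := by
    unfold zetaR
    refine (ak_summable 2 le_rfl).tsum_le_of_sum_range_le fun N => ?_
    have := ak_sum_inv_sq N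
    refine le_trans (le_of_eq ?_) this
    rw [Finset.range_eq_Ico, Finset.sum_Ico_eq_sum_range, ← Finset.Ico_succ_right_eq_Icc, Finset.sum_Ico_eq_sum_range]
    refine Finset.sum_congr (by simp) fun n _ => ?_
    push_cast
    simp only [one_div, add_comm, add_zero]
  have hb := tsum_of_norm_bounded hbase (f := fun n : ℕ =>
    (ArithmeticFunction.moebius (n+(H+1)) : ℝ) / ((n+(H+1):ℕ):ℝ)^s) (fun n => by
      rw [norm_div, Real.norm_eq_abs, Real.norm_of_nonneg (by positivity)]
      have h1 : |(ArithmeticFunction.moebius (n+(H+1)) : ℝ)| ≤ 1 := by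
        exact_mod_cast ArithmeticFunction.abs_moebius_le_one
      rw [div_div]
      refine div_le_div₀ zero_le_one h1 (by positivity) ?_
      obtain ⟨t, rfl⟩ : ∃ t, s = t + 3 := ⟨s - 3, by omega⟩
      push_cast
      have hn : (0:ℝ) ≤ n := by positivity
      calc ((n:ℝ)+1)^2 * H ≤ ((n:ℝ) + (H+1))^2 * ((n:ℝ) + (H+1)) := by gcongr <;> linarith
        _ = 1 * ((n:ℝ) + (H+1))^3 := by ring
        _ ≤ ((n:ℝ) + (H+1))^t * ((n:ℝ) + (H+1))^3 := by
          gcongr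
          exact one_le_pow₀ (by linarith)
        _ = _ := by rw [← pow_add])
  rw [Real.norm_eq_abs] at hb
  refine hb.trans ?_
  gcongr

lemma ak_J_bounds (d : ℕ) (I : Set ℝ) (hI : I ⊆ Icc 0 1) (hm : MeasurableSet I) :
    0 ≤ ∫ x in I, rho d x ∧ ∫ x in I, rho d x ≤ 2 ^ d * (d:ℝ)^2 := by
  have hvt : volume I < ⊤ := (measure_mono hI).trans_lt (by simp)
  constructor
  · exact integral_nonneg fun x => ak_rho_nonneg d x
  · have := norm_setIntegral_le_of_norm_le_const (μ := volume) (s := I) (f := rho d)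
      (C := 2 ^ d * (d:ℝ)^2) hvt (fun x hx => by
        rw [Real.norm_of_nonneg (ak_rho_nonneg d x)]; exact ak_rho_le d x (hI hx))
    refine (le_abs_self _).trans (this.trans ?_)
    have h4 : 0 ≤ 2 ^ d * (d:ℝ)^2 := by positivity
    nlinarith [ak_vol_le I hI]

lemma ak_A_real (d H n : ℕ) (hd : 2 ≤ d) (hn : 1 ≤ n) (hnH : n ≤ H) (I : Set ℝ) (hI : I ⊆ Icc 0 1)
    (hc : I.OrdConnected) :
    |akA I d (H / n) - ((H:ℝ)/n)^(d+1) * ∫ x in I, rho d x| ≤ 14 * (d:ℝ)^3 * 3^d * ((H:ℝ)/n)^d := by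
  set J := ∫ x in I, rho d x with hJ
  obtain ⟨hJ0, hJ1⟩ := ak_J_bounds d I hI hc.measurableSet
  have hq : 1 ≤ H / n := (Nat.one_le_div_iff hn).2 hnH
  have h1 := ak_A_asymp d (H/n) (by omega) hq I hI hc
  set q := H / n
  set X := (H:ℝ)/n
  have hn0 : (0:ℝ) < n := by exact_mod_cast hn
  have hqX : (q:ℝ) ≤ X := Nat.cast_div_le
  have hXq : X ≤ q + 1 := by
    rw [div_le_iff₀ hn0]
    have : H < (q + 1) * n := by
      have := Nat.lt_div_mul_add (a := H) (b := n) hn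
      rw [add_mul, one_mul]; exact this
    exact_mod_cast this.le
  have hX0 : 0 ≤ X := by positivity
  have hp := abs_pow_sub_pow_le X (q:ℝ) (d+1)
  rw [abs_of_nonneg (by linarith : (0:ℝ) ≤ X - q), Nat.abs_cast, abs_of_nonneg hX0,
    max_eq_left hqX, Nat.add_sub_cancel] at hp
  have hp2 : |X^(d+1) - (q:ℝ)^(d+1)| ≤ (d+1) * X^d := by
    refine hp.trans ?_
    push_cast
    have : 0 ≤ ((d:ℝ)+1) * X^d := by positivity
    nlinarith
  have hd' : (2:ℝ) ≤ d := by exact_mod_cast hd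
  have h2 : |(q:ℝ)^(d+1) * J - X^(d+1) * J| ≤ 3 * (d:ℝ)^3 * 3^d * X^d := by
    rw [← sub_mul, abs_mul, abs_sub_comm, abs_of_nonneg hJ0]
    calc |X^(d+1) - (q:ℝ)^(d+1)| * J ≤ ((d+1) * X^d) * (2 ^ d * (d:ℝ)^2) := by gcongr
      _ ≤ ((3 * d) * X^d) * (3 ^ d * (d:ℝ)^2) := by
        gcongr
        · linarith
        · norm_num
      _ = _ := by ring
  have h3 : 11 * (d:ℝ)^3 * 3^d * (q:ℝ)^d ≤ 11 * (d:ℝ)^3 * 3^d * X^d := by gcongr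
  have := abs_sub_le (akA I d q) ((q:ℝ)^(d+1) * J) (X^(d+1) * J)
  linarith

lemma ak_Ap_asymp (d H : ℕ) (hd : 2 ≤ d) (hH : 1 ≤ H) (I : Set ℝ) (hI : I ⊆ Icc 0 1)
    (hc : I.OrdConnected) :
    |akAp I d H - (H:ℝ)^(d+1) * (∫ x in I, rho d x) / zetaR (d+1)| ≤
      30 * (d:ℝ)^3 * 3^d * (H:ℝ)^d := by
  set J := ∫ x in I, rho d x with hJ
  obtain ⟨hJ0, hJ1⟩ := ak_J_bounds d I hI hc.measurableSet
  have hH' : (1:ℝ) ≤ H := by exact_mod_cast hH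
  have hd' : (2:ℝ) ≤ d := by exact_mod_cast hd
  have h1 : |akAp I d H - (H:ℝ)^(d+1) * J *
      ∑ n ∈ Finset.Icc 1 H, (ArithmeticFunction.moebius n : ℝ) / (n:ℝ)^(d+1)| ≤
      28 * (d:ℝ)^3 * 3^d * (H:ℝ)^d := by
    rw [ak_Ap_eq, Finset.mul_sum, ← Finset.sum_sub_distrib]
    have hb : ∀ n ∈ Finset.Icc 1 H, |(ArithmeticFunction.moebius n : ℝ) * akA I d (H / n) -
        (H:ℝ)^(d+1) * J * ((ArithmeticFunction.moebius n : ℝ) / (n:ℝ)^(d+1))| ≤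
        14 * (d:ℝ)^3 * 3^d * (H:ℝ)^d * ((n:ℝ)^2)⁻¹ := by
      intro n hn
      rw [Finset.mem_Icc] at hn
      have h2 := ak_A_real d H n hd hn.1 hn.2 I hI hc
      have hn1 : (1:ℝ) ≤ n := by exact_mod_cast hn.1
      have e : (ArithmeticFunction.moebius n : ℝ) * akA I d (H / n) -
        (H:ℝ)^(d+1) * J * ((ArithmeticFunction.moebius n : ℝ) / (n:ℝ)^(d+1)) =
        (ArithmeticFunction.moebius n : ℝ) * (akA I d (H / n) - ((H:ℝ)/n)^(d+1) * J) := by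
        rw [div_pow]; ring
      rw [e, abs_mul]
      have hmu : |(ArithmeticFunction.moebius n : ℝ)| ≤ 1 := by
        exact_mod_cast ArithmeticFunction.abs_moebius_le_one
      calc _ ≤ 1 * (14 * (d:ℝ)^3 * 3^d * ((H:ℝ)/n)^d) := by gcongr
        _ = 14 * (d:ℝ)^3 * 3^d * (H:ℝ)^d * ((n:ℝ)^d)⁻¹ := by rw [div_pow]; ring
        _ ≤ _ := by gcongr
    refine (Finset.abs_sum_le_sum_abs _ _).trans ((Finset.sum_le_sum hb).trans ?_)
    rw [← Finset.mul_sum]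
    have := ak_sum_inv_sq H
    have h4 : 0 ≤ 14 * (d:ℝ)^3 * 3^d * (H:ℝ)^d := by positivity
    nlinarith
  have h2 := ak_mu_tail (d+1) H (by omega) hH
  set M := ∑ n ∈ Finset.Icc 1 H, (ArithmeticFunction.moebius n : ℝ) / (n:ℝ)^(d+1)
  have h3 : |(H:ℝ)^(d+1) * J * M - (H:ℝ)^(d+1) * J / zetaR (d+1)| ≤ 2 * (d:ℝ)^3 * 3^d * (H:ℝ)^d := by
    rw [div_eq_mul_inv, ← mul_sub, abs_mul, abs_of_nonneg (by positivity)]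
    calc (H:ℝ)^(d+1) * J * |M - (zetaR (d+1))⁻¹| ≤ (H:ℝ)^(d+1) * (2 ^ d * (d:ℝ)^2) * (2 / H) := by gcongr
      _ = 2 * ((d:ℝ)^2 * 1) * 2^d * (H:ℝ)^d := by field_simp; ring
      _ ≤ 2 * ((d:ℝ)^2 * d) * 3^d * (H:ℝ)^d := by
        gcongr
        · linarith
        · norm_num
      _ = _ := by ring
  have := abs_sub_le (akAp I d H) ((H:ℝ)^(d+1) * J * M) ((H:ℝ)^(d+1) * J / zetaR (d+1))
  linarith

open Polynomial in
lemma ak_gelfond (P Q R : ℤ[X]) (d H : ℕ) (hP : P = Q * R) (hPd : P.natDegree = d) (hP0 : P ≠ 0)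
    (hH : ∀ k, |P.coeff k| ≤ H) (j k : ℕ) :
    |Q.coeff j| * |R.coeff k| ≤ ((2 ^ d * (d+1) * H : ℕ) : ℤ) := by
  set c : ℤ →+* ℂ := Int.castRingHom ℂ
  have hcn : ∀ (S : ℤ[X]) (n : ℕ), ‖(S.map c).coeff n‖ = |(S.coeff n : ℝ)| := by
    intro S n
    simp [c, coeff_map]
  have hb : ∀ (S : ℤ[X]) (n : ℕ), |(S.coeff n : ℝ)| ≤ 2 ^ S.natDegree * (S.map c).mahlerMeasure := by
    intro S n
    have h := norm_coeff_le_choose_mul_mahlerMeasure n (S.map c)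
    rw [hcn] at h
    refine h.trans ?_
    have h2 : (((S.map c).natDegree.choose n : ℕ) : ℝ) ≤ 2 ^ S.natDegree := by
      have h3 := Nat.choose_le_two_pow (S.map c).natDegree n
      have h4 : (S.map c).natDegree ≤ S.natDegree := natDegree_map_le
      have h5 : 2 ^ (S.map c).natDegree ≤ 2 ^ S.natDegree := Nat.pow_le_pow_right (by norm_num) h4
      exact_mod_cast h3.trans h5
    have := mahlerMeasure_nonneg (S.map c)
    gcongr
  have hQ0 : Q ≠ 0 := by rintro rfl; simp at hP; exact hP0 hP
  have hR0 : R ≠ 0 := by rintro rfl; simp at hP; exact hP0 hP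
  have hdeg : Q.natDegree + R.natDegree = d := by
    rw [← hPd, hP, natDegree_mul hQ0 hR0]
  have hM : (P.map c).mahlerMeasure ≤ (d+1) * H := by
    refine (mahlerMeasure_le_sum_norm_coeff _).trans ?_
    rw [sum_over_range' _ (by simp) (d+1) (by
      have : (P.map c).natDegree ≤ P.natDegree := natDegree_map_le
      omega)]
    refine (Finset.sum_le_sum (g := fun _ => (H:ℝ)) fun n _ => ?_).trans ?_
    · rw [hcn]; exact_mod_cast hH n
    · simp
  rw [hP, Polynomial.map_mul, mahlerMeasure_mul] at hM
  have h1 := hb Q j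
  have h2 := hb R k
  have h3 := mahlerMeasure_nonneg (Q.map c)
  have h4 := mahlerMeasure_nonneg (R.map c)
  have : |(Q.coeff j : ℝ)| * |(R.coeff k : ℝ)| ≤ 2 ^ d * (d+1) * H := by
    calc |(Q.coeff j : ℝ)| * |(R.coeff k : ℝ)| ≤ (2 ^ Q.natDegree * (Q.map c).mahlerMeasure) *
          (2 ^ R.natDegree * (R.map c).mahlerMeasure) := by gcongr
      _ = 2 ^ d * ((Q.map c).mahlerMeasure * (R.map c).mahlerMeasure) := by
        rw [← hdeg, pow_add]; ring
      _ ≤ 2 ^ d * ((d+1) * H) := by gcongr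
      _ = _ := by ring
  exact_mod_cast this

open Polynomial in
lemma ak_factor (d H : ℕ) (hd : 2 ≤ d) (v : Fin (d+1) → ℤ) (hg : akG v = 1)
    (hdeg : (akPoly v).natDegree = d) (hirr : ¬ Irreducible (akPoly v)) :
    ∃ Q R : ℤ[X], akPoly v = Q * R ∧ 1 ≤ Q.natDegree ∧ 2 * Q.natDegree ≤ d ∧
      R.natDegree = d - Q.natDegree := by
  have hP0 : akPoly v ≠ 0 := by
    intro h; rw [h] at hdeg; simp at hdeg; omega
  have hnu : ¬ IsUnit (akPoly v) := by
    intro h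
    have := natDegree_eq_zero_of_isUnit h
    omega
  have hconst : ∀ a b : ℤ[X], akPoly v = a * b → a.natDegree = 0 → IsUnit a := by
    intro a b hab ha
    rw [eq_C_of_natDegree_eq_zero ha] at hab ⊢
    set c := a.coeff 0
    have : c.natAbs ∣ akG v := by
      rw [ak_dvd_G]
      intro i
      have h1 : v i = (akPoly v).coeff i := by
        rw [ak_coeff, dif_pos i.2]
      rw [h1, hab, coeff_C_mul, Int.natAbs_dvd]
      exact Dvd.intro _ rfl
    rw [hg, Nat.dvd_one] at this
    exact isUnit_C.2 (Int.isUnit_iff_natAbs_eq.2 this)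
  have : ∃ a b : ℤ[X], akPoly v = a * b ∧ ¬ IsUnit a ∧ ¬ IsUnit b := by
    by_contra hcon
    push Not at hcon
    apply hirr
    refine ⟨hnu, fun {a b} hab => ?_⟩
    by_cases ha : IsUnit a
    · exact Or.inl ha
    · exact Or.inr (hcon a b hab ha)
  obtain ⟨a, b, hab, hna, hnb⟩ := this
  have ha1 : a.natDegree ≠ 0 := fun h => hna (hconst a b hab h)
  have hb1 : b.natDegree ≠ 0 := fun h => hnb (hconst b a (by rw [hab, mul_comm]) h)
  have ha0 : a ≠ 0 := by rintro rfl; simp at ha1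
  have hb0 : b ≠ 0 := by rintro rfl; simp at hb1
  have hsum : a.natDegree + b.natDegree = d := by
    rw [← hdeg, hab, natDegree_mul ha0 hb0]
  rcases le_total a.natDegree b.natDegree with h | h
  · exact ⟨a, b, hab, by omega, by omega, by omega⟩
  · exact ⟨b, a, by rw [hab, mul_comm], by omega, by omega, by omega⟩

open Polynomial in
lemma ak_poly_of (n : ℕ) (Q : ℤ[X]) (hQ : Q.natDegree ≤ n) :
    akPoly (fun k : Fin (n+1) => Q.coeff k) = Q := by
  ext k
  rw [ak_coeff]
  split_ifs with h
  · rfl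
  · rw [coeff_eq_zero_of_natDegree_lt (by omega)]

def akPairs (a b T : ℕ) : Finset ((Fin (a+1) → ℤ) × (Fin (b+1) → ℤ)) :=
  (Finset.Icc 1 T).biUnion fun h => (akBox (a+1) h \ akBox (a+1) (h-1)) ×ˢ akBox (b+1) (T / h)

lemma ak_mem_pairs (a b T : ℕ) (u : Fin (a+1) → ℤ) (w : Fin (b+1) → ℤ) (hu : u ≠ 0) (hw : w ≠ 0)
    (h : ∀ j k, |u j| * |w k| ≤ (T:ℤ)) : (u, w) ∈ akPairs a b T := by
  have hex : ∃ h, u ∈ akBox (a+1) h := by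
    refine ⟨T, ?_⟩
    obtain ⟨k, hk⟩ := Function.ne_iff.1 hw
    rw [ak_mem_box]
    intro j
    have h1 := h j k
    have h2 : 1 ≤ |w k| := Int.one_le_abs hk
    nlinarith [abs_nonneg (u j)]
  classical
  set m := Nat.find hex with hm
  have hm1 : u ∈ akBox (a+1) m := Nat.find_spec hex
  have hm0 : 1 ≤ m := by
    by_contra hcon
    have h0 : m = 0 := by omega
    rw [h0, ak_mem_box] at hm1
    apply hu
    ext k
    have := hm1 k
    simpa using this
  have hm2 : u ∉ akBox (a+1) (m-1) := Nat.find_min hex (by omega)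
  have hj : ∃ j, (m:ℤ) ≤ |u j| := by
    by_contra hcon
    push Not at hcon
    apply hm2
    rw [ak_mem_box]
    intro k
    have := hcon k
    omega
  obtain ⟨j, hj⟩ := hj
  have hwk : ∀ k, (m:ℤ) * |w k| ≤ T := fun k =>
    (mul_le_mul_of_nonneg_right hj (abs_nonneg _)).trans (h j k)
  simp only [akPairs, Finset.mem_biUnion, Finset.mem_product, Finset.mem_sdiff, Finset.mem_Icc]
  refine ⟨m, ⟨hm0, ?_⟩, ⟨hm1, hm2⟩, ?_⟩
  · obtain ⟨k, hk⟩ := Function.ne_iff.1 hw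
    have h2 : 1 ≤ |w k| := Int.one_le_abs hk
    have h1 := hwk k
    have : (m:ℤ) ≤ T := by nlinarith
    exact_mod_cast this
  · rw [ak_mem_box]
    intro k
    push_cast
    rw [Int.le_ediv_iff_mul_le (by omega)]
    linarith [hwk k]

def akLog (d T : ℕ) : ℝ := if d = 2 then 1 + Real.log T else 2

lemma ak_sum_harm (T : ℕ) : ∑ h ∈ Finset.Icc 1 T, ((h:ℝ))⁻¹ ≤ 1 + Real.log T := by
  have := harmonic_le_one_add_log T
  rw [harmonic_eq_sum_Icc] at this
  push_cast at this
  exact this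

lemma ak_hsum (a b T : ℕ) (ha : 1 ≤ a) (hab : a ≤ b) :
    ∑ h ∈ Finset.Icc 1 T, (h:ℝ)^a * ((T:ℝ)/h)^(b+1) ≤ (T:ℝ)^(a+b) * akLog (a+b) T := by
  rcases Nat.eq_zero_or_pos T with hT0 | hT
  · subst hT0
    have h0 : a + b ≠ 0 := by omega
    rw [Nat.cast_zero, zero_pow h0]
    simp
  have hT' : (1:ℝ) ≤ T := by exact_mod_cast hT
  rcases Nat.eq_or_lt_of_le ha with h1 | h1
  · subst h1
    rcases Nat.eq_or_lt_of_le hab with h2 | h2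
    · subst h2
      have : akLog (1+1) T = 1 + Real.log T := by simp [akLog]
      rw [this]
      refine le_trans (le_of_eq ?_) (mul_le_mul_of_nonneg_left (ak_sum_harm T) (by positivity))
      rw [Finset.mul_sum]
      refine Finset.sum_congr rfl fun h hh => ?_
      have : (h:ℝ) ≠ 0 := by rw [Finset.mem_Icc] at hh; exact_mod_cast (by omega : h ≠ 0)
      rw [div_pow]
      field_simp
    · have : akLog (1+b) T = 2 := by unfold akLog; rw [if_neg (by omega)]
      rw [this]
      refine le_trans ?_ (mul_le_mul_of_nonneg_left (ak_sum_inv_sq T) (by positivity))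
      rw [Finset.mul_sum]
      refine Finset.sum_le_sum fun h hh => ?_
      rw [Finset.mem_Icc] at hh
      have h0 : (1:ℝ) ≤ h := by exact_mod_cast hh.1
      have e : (h:ℝ)^1 * ((T:ℝ)/h)^(b+1) = (T:ℝ)^(1+b) * ((h:ℝ)^b)⁻¹ := by
        rw [div_pow, pow_succ (h:ℝ) b, add_comm 1 b]; field_simp
      rw [e]
      gcongr
      omega
  · have : akLog (a+b) T = 2 := by unfold akLog; rw [if_neg (by omega)]
    rw [this]
    have hb : ∀ h ∈ Finset.Icc 1 T, (h:ℝ)^a * ((T:ℝ)/h)^(b+1) ≤ (T:ℝ)^(b+1) := by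
      intro h hh
      rw [Finset.mem_Icc] at hh
      have h0 : (1:ℝ) ≤ h := by exact_mod_cast hh.1
      rw [div_pow, ← mul_div_assoc, div_le_iff₀ (by positivity), mul_comm]
      gcongr
      omega
    refine (Finset.sum_le_sum hb).trans ?_
    rw [Finset.sum_const, Nat.card_Icc, nsmul_eq_mul]
    simp only [Nat.add_sub_cancel]
    have h3 : (T:ℝ) * (T:ℝ)^(b+1) ≤ (T:ℝ)^(a+b) := by
      rw [← pow_succ']
      exact pow_le_pow_right₀ hT' (by omega)
    have : 0 ≤ (T:ℝ)^(a+b) := by positivity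
    linarith

lemma ak_card_pairs (a b T : ℕ) (ha : 1 ≤ a) (hab : a ≤ b) :
    ((akPairs a b T).card : ℝ) ≤ 2 * ((a+b:ℕ)+1) * 3^(a+b+1) * ((T:ℝ)^(a+b) * akLog (a+b) T) := by
  have h1 : ((akPairs a b T).card : ℝ) ≤ ∑ h ∈ Finset.Icc 1 T,
      (2 * ((a+b:ℕ)+1) * 3^(a+b+1)) * ((h:ℝ)^a * ((T:ℝ)/h)^(b+1)) := by
    refine (Nat.cast_le.2 Finset.card_biUnion_le).trans ?_
    push_cast
    refine Finset.sum_le_sum fun h hh => ?_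
    rw [Finset.mem_Icc] at hh
    rw [Finset.card_product, ak_card_box]
    have hs : akBox (a+1) (h-1) ⊆ akBox (a+1) h := by
      intro v hv
      rw [ak_mem_box] at hv ⊢
      intro k
      have := hv k
      omega
    rw [Finset.card_sdiff_of_subset hs, ak_card_box, ak_card_box]
    have hp := ak_pow_sub (2*h+1) (2*(h-1)+1) (by omega) a
    have e : 2*h+1 - (2*(h-1)+1) = 2 := by omega
    rw [e] at hp
    have hp' : (((2*h+1)^(a+1) - (2*(h-1)+1)^(a+1) : ℕ) : ℝ) ≤ (a+1) * 2 * (2*h+1)^a := by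
      exact_mod_cast hp
    have h0 : (1:ℝ) ≤ h := by exact_mod_cast hh.1
    have hq : 1 ≤ T / h := (Nat.one_le_div_iff hh.1).2 hh.2
    have hq' : ((T / h : ℕ) : ℝ) ≤ (T:ℝ)/h := Nat.cast_div_le
    have hq1 : (1:ℝ) ≤ ((T / h : ℕ) : ℝ) := by exact_mod_cast hq
    push_cast
    calc _ ≤ (((a:ℝ)+1) * 2 * (2*h+1)^a) * (2 * ((T / h : ℕ) : ℝ) + 1)^(b+1) := by gcongr
      _ ≤ (((a:ℝ)+b+1) * 2 * (3*h)^a) * (3 * ((T:ℝ)/h))^(b+1) := by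
        gcongr
        · have : (0:ℝ) ≤ b := by positivity
          linarith
        · linarith
        · linarith
      _ = _ := by rw [mul_pow, mul_pow]; ring
  refine h1.trans ?_
  rw [← Finset.mul_sum]
  have := ak_hsum a b T ha hab
  gcongr

open Classical in
def akBad (d H : ℕ) : Finset (Fin (d+1) → ℤ) := (akBox (d+1) H).filter fun v =>
  akG v = 1 ∧ (akPoly v).natDegree = d ∧ ¬ Irreducible (akPoly v)

lemma ak_card_bad (d H : ℕ) (hd : 2 ≤ d) :
    ((akBad d H).card : ℝ) ≤ d * (2 * ((d:ℝ)+1) * 3^(d+1) *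
      (((2 ^ d * (d+1) * H : ℕ) : ℝ)^d * akLog d (2 ^ d * (d+1) * H))) := by
  classical
  set T := 2 ^ d * (d+1) * H
  have hsub : (akBad d H).image akPoly ⊆ (Finset.Icc 1 (d/2)).biUnion fun i =>
      (akPairs i (d-i) T).image fun z => akPoly z.1 * akPoly z.2 := by
    intro P hP
    rw [Finset.mem_image] at hP
    obtain ⟨v, hv, rfl⟩ := hP
    simp only [akBad, Finset.mem_filter] at hv
    obtain ⟨hbox, hg, hdeg, hirr⟩ := hv
    obtain ⟨Q, R, hQR, h1, h2, h3⟩ := ak_factor d H hd v hg hdeg hirr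
    have hP0 : akPoly v ≠ 0 := by
      intro h; rw [h] at hdeg; simp at hdeg; omega
    have hgel := ak_gelfond (akPoly v) Q R d H hQR hdeg hP0 (by
      intro k
      rw [ak_coeff]
      split_ifs with h
      · exact ak_mem_box.1 hbox _
      · simp)
    rw [Finset.mem_biUnion]
    refine ⟨Q.natDegree, ?_, ?_⟩
    · rw [Finset.mem_Icc]; omega
    rw [Finset.mem_image]
    have eQ := ak_poly_of Q.natDegree Q le_rfl
    have eR := ak_poly_of (d - Q.natDegree) R h3.le
    refine ⟨(fun k => Q.coeff k, fun k => R.coeff k), ?_, ?_⟩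
    · apply ak_mem_pairs
      · intro h0
        rw [h0, ak_poly_zero] at eQ
        rw [← eQ] at h1; simp at h1
      · intro h0
        rw [h0, ak_poly_zero] at eR
        rw [hQR, ← eR, mul_zero] at hP0
        exact hP0 rfl
      · intro j k; exact hgel j k
    · simp only
      rw [eQ, eR, hQR]
  have hcard := Finset.card_le_card hsub
  rw [Finset.card_image_of_injective _ ak_poly_inj] at hcard
  have hcard2 := hcard.trans Finset.card_biUnion_le
  have hL0 : 0 ≤ akLog d T := by
    unfold akLog
    split_ifs
    · have := Real.log_natCast_nonneg T
      linarith
    · norm_num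
  have h4 : ((akBad d H).card : ℝ) ≤ ∑ i ∈ Finset.Icc 1 (d/2),
      2 * ((d:ℝ)+1) * 3^(d+1) * ((T:ℝ)^d * akLog d T) := by
    refine (Nat.cast_le.2 hcard2).trans ?_
    push_cast
    refine Finset.sum_le_sum fun i hi => ?_
    rw [Finset.mem_Icc] at hi
    refine (Nat.cast_le.2 Finset.card_image_le).trans ?_
    have h := ak_card_pairs i (d-i) T hi.1 (by omega)
    rw [show i + (d - i) = d by omega] at h
    exact h
  refine h4.trans ?_
  rw [Finset.sum_const, Nat.card_Icc, nsmul_eq_mul]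
  gcongr
  omega

lemma ak_log_bound (d H : ℕ) (hH : 2 ≤ H) :
    akLog d (2 ^ d * (d+1) * H) ≤ 7 * Real.log H ^ lfun d := by
  unfold akLog lfun
  split_ifs with h
  · subst h
    have hH' : (2:ℝ) ≤ H := by exact_mod_cast hH
    push_cast
    rw [Real.log_mul (by norm_num) (by positivity), pow_one]
    have h1 : Real.log 12 ≤ 4 * Real.log 2 := by
      rw [← Real.log_rpow (by norm_num)]
      apply Real.log_le_log (by norm_num)
      norm_num
    have h2 : Real.log 2 ≤ Real.log H := Real.log_le_log (by norm_num) hH'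
    have h3 := Real.log_two_gt_d9
    norm_num
    norm_num at h3
    linarith
  · norm_num

lemma ak_card_bad' (d H : ℕ) (hd : 2 ≤ d) (hH : 2 ≤ H) :
    ((akBad d H).card : ℝ) ≤ 14 * d * ((d:ℝ)+1) * 3^(d+1) * (2^d * ((d:ℝ)+1))^d *
      ((H:ℝ)^d * Real.log H ^ lfun d) := by
  refine (ak_card_bad d H hd).trans ?_
  have := ak_log_bound d H hH
  calc _ ≤ d * (2 * ((d:ℝ)+1) * 3^(d+1) *
      (((2 ^ d * (d+1) * H : ℕ) : ℝ)^d * (7 * Real.log H ^ lfun d))) := by gcongr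
    _ = _ := by push_cast; rw [mul_pow _ (H:ℝ)]; ring

open Polynomial in
lemma ak_assoc (P Q : ℤ[X]) (hP : Irreducible P) (hQ : Irreducible Q) (hPd : P.natDegree ≠ 0)
    (hQd : Q.natDegree ≠ 0) (a : ℝ) (h1 : aeval a P = 0) (h2 : aeval a Q = 0) : Q = P ∨ Q = -P := by
  have pP := hP.isPrimitive hPd
  have pQ := hQ.isPrimitive hQd
  have iP := (IsPrimitive.Int.irreducible_iff_irreducible_map_cast pP).1 hP
  have iQ := (IsPrimitive.Int.irreducible_iff_irreducible_map_cast pQ).1 hQ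
  have e : ∀ R : ℤ[X], aeval a (R.map (Int.castRingHom ℚ)) = aeval a R := by
    intro R
    rw [← algebraMap_int_eq, aeval_map_algebraMap]
  have d1 := minpoly.dvd ℚ a ((e P).trans h1)
  have d2 := minpoly.dvd ℚ a ((e Q).trans h2)
  have hnu : ¬ IsUnit (minpoly ℚ a) := minpoly.not_isUnit ℚ a
  have d3 : P.map (Int.castRingHom ℚ) ∣ Q.map (Int.castRingHom ℚ) :=
    ((iP.dvd_iff.1 d1).resolve_left hnu).dvd.trans d2
  have d4 := (IsPrimitive.Int.dvd_iff_map_cast_dvd_map_cast P Q pP).2 d3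
  obtain ⟨u, hu⟩ := hP.associated_of_dvd hQ d4
  obtain ⟨r, hr, hru⟩ := Polynomial.isUnit_iff.1 u.isUnit
  rw [← hu, ← hru]
  rcases Int.isUnit_iff.1 hr with rfl | rfl
  · left; simp
  · right; simp

open Classical in
def akIrr (d H : ℕ) : Finset (Fin (d+1) → ℤ) := (akBox (d+1) H).filter fun v =>
  (akPoly v).natDegree = d ∧ Irreducible (akPoly v)

def akSet (I : Set ℝ) (d H : ℕ) : Set ℝ := {α : ℝ | α ∈ algSet d H ∧ α ∈ I}

lemma ak_poly_neg {n : ℕ} (v : Fin n → ℤ) : akPoly (-v) = - akPoly v := by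
  simp [akPoly]

lemma ak_algSet_iff (d H : ℕ) (a : ℝ) :
    a ∈ algSet d H ↔ ∃ v ∈ akIrr d H, Polynomial.aeval a (akPoly v) = 0 := by
  constructor
  · rintro ⟨P, hP, hd, hk, ha⟩
    have e := ak_poly_of d P hd.le
    refine ⟨fun k => P.coeff k, ?_, by rw [e]; exact ha⟩
    simp only [akIrr, Finset.mem_filter, ak_mem_box, e]
    refine ⟨fun k => ?_, hd, hP⟩
    exact_mod_cast hk k
  · rintro ⟨v, hv, ha⟩
    simp only [akIrr, Finset.mem_filter, ak_mem_box] at hv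
    refine ⟨akPoly v, hv.2.2, hv.2.1, ?_, ha⟩
    intro k
    rw [ak_coeff]
    split_ifs with h
    · exact_mod_cast hv.1 _
    · simp

open Classical in
def akFin (I : Set ℝ) (d H : ℕ) : Finset ℝ := (akIrr d H).biUnion fun v =>
  ((Polynomial.rootSet_finite (akPoly v) ℝ).toFinset).filter (· ∈ I)

lemma ak_root_iff (d H : ℕ) (hd : 2 ≤ d) (v : Fin (d+1) → ℤ) (hv : v ∈ akIrr d H) (a : ℝ) :
    a ∈ (akPoly v).rootSet ℝ ↔ Polynomial.aeval a (akPoly v) = 0 := by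
  simp only [akIrr, Finset.mem_filter] at hv
  rw [Polynomial.mem_rootSet]
  have : akPoly v ≠ 0 := hv.2.2.ne_zero
  tauto

lemma ak_fin_coe (I : Set ℝ) (d H : ℕ) (hd : 2 ≤ d) : (akFin I d H : Set ℝ) = akSet I d H := by
  ext a
  simp only [akFin, Finset.coe_biUnion, Finset.mem_coe, Set.mem_iUnion, Finset.mem_filter,
    Set.Finite.mem_toFinset, akSet, Set.mem_ofPred_eq, ak_algSet_iff, exists_prop]
  constructor
  · rintro ⟨v, hv, h1, h2⟩
    exact ⟨⟨v, hv, (ak_root_iff d H hd v hv a).1 h1⟩, h2⟩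
  · rintro ⟨⟨v, hv, h1⟩, h2⟩
    exact ⟨v, hv, (ak_root_iff d H hd v hv a).2 h1, h2⟩

lemma ak_double (I : Set ℝ) (d H : ℕ) (hd : 2 ≤ d) :
    ∑ v ∈ akIrr d H, akN I (akPoly v) = 2 * (akSet I d H).ncard := by
  classical
  have h := Finset.sum_card_bipartiteAbove_eq_sum_card_bipartiteBelow (s := akIrr d H)
    (t := akFin I d H) (fun v a => Polynomial.aeval a (akPoly v) = 0)
  have h1 : ∀ v ∈ akIrr d H, (Finset.bipartiteAbove (fun (v : Fin (d+1) → ℤ) (a:ℝ) =>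
      Polynomial.aeval a (akPoly v) = 0) (akFin I d H) v).card = akN I (akPoly v) := by
    intro v hv
    rw [akN, ← Set.ncard_coe_finset]
    congr 1
    ext a
    have hf := Set.ext_iff.1 (ak_fin_coe I d H hd) a
    simp only [Finset.mem_coe] at hf
    simp only [Finset.mem_coe, Finset.mem_bipartiteAbove, hf, Set.mem_inter_iff,
      ak_root_iff d H hd v hv, akSet, Set.mem_ofPred_eq, ak_algSet_iff]
    constructor
    · rintro ⟨⟨_, h2⟩, h3⟩; exact ⟨h3, h2⟩
    · rintro ⟨h3, h2⟩; exact ⟨⟨⟨v, hv, h3⟩, h2⟩, h3⟩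
  have h2 : ∀ a ∈ akFin I d H, (Finset.bipartiteBelow (fun (v : Fin (d+1) → ℤ) (a:ℝ) =>
      Polynomial.aeval a (akPoly v) = 0) (akIrr d H) a).card = 2 := by
    intro a ha
    have hf := Set.ext_iff.1 (ak_fin_coe I d H hd) a
    simp only [Finset.mem_coe] at hf
    have ha2 := (hf.1 ha).1
    rw [ak_algSet_iff] at ha2
    obtain ⟨v, hv, hva⟩ := ha2
    have hv' := hv
    simp only [akIrr, Finset.mem_filter, ak_mem_box] at hv'
    rw [Finset.card_eq_two]
    refine ⟨v, -v, ?_, ?_⟩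
    · intro h0
      have : akPoly v = - akPoly v := by rw [← ak_poly_neg, ← h0]
      exact hv'.2.2.ne_zero (self_eq_neg.1 this)
    · ext w
      simp only [Finset.mem_bipartiteBelow, Finset.mem_insert, Finset.mem_singleton]
      constructor
      · rintro ⟨hw, hwa⟩
        simp only [akIrr, Finset.mem_filter, ak_mem_box] at hw
        rcases ak_assoc _ _ hv'.2.2 hw.2.2 (by omega) (by omega) a hva hwa with h | h
        · left; exact ak_poly_inj h
        · right; rw [← ak_poly_neg] at h; exact ak_poly_inj h
      · rintro (rfl | rfl)
        · exact ⟨hv, hva⟩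
        · simp only [akIrr, Finset.mem_filter, ak_mem_box, ak_poly_neg, Polynomial.natDegree_neg,
            map_neg, hva, neg_zero, Pi.neg_apply, abs_neg, and_true]
          exact ⟨hv'.1, hv'.2.1, (Associated.irreducible_iff (Associated.neg_left
            (Associated.refl _))).2 hv'.2.2⟩
  rw [Finset.sum_congr rfl h1, Finset.sum_congr rfl h2] at h
  rw [h, ← ak_fin_coe I d H hd, Set.ncard_coe_finset]
  simp [mul_comm]

lemma ak_card_last (d H : ℕ) :
    ((akBox (d+1) H).filter fun v => v (Fin.last d) = 0).card ≤ (2*H+1)^d := by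
  rw [← ak_card_box]
  apply Finset.card_le_card_of_injOn (fun v k => v (Fin.castSucc k))
  · intro v hv
    simp only [Finset.coe_filter, Set.mem_ofPred_eq, ak_mem_box] at hv
    simp only [Finset.mem_coe, ak_mem_box]
    intro k
    exact hv.1 _
  · intro v hv w hw h
    simp only [Finset.coe_filter, Set.mem_ofPred_eq] at hv hw
    ext k
    refine Fin.lastCases ?_ (fun i => ?_) k
    · rw [hv.2, hw.2]
    · exact congrFun h i

lemma ak_G_of_irr (d : ℕ) (hd : 2 ≤ d) (v : Fin (d+1) → ℤ) (h1 : (akPoly v).natDegree = d)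
    (h2 : Irreducible (akPoly v)) : akG v = 1 := by
  have hp := h2.isPrimitive (by omega)
  have h3 := hp (akG v : ℤ) (by
    rw [Polynomial.C_dvd_iff_dvd_coeff]
    intro k
    rw [ak_coeff]
    split_ifs with h
    · exact (ak_dvd_G v _).1 dvd_rfl _
    · simp)
  rw [Int.isUnit_iff] at h3
  omega

lemma ak_irr_diff (I : Set ℝ) (d H : ℕ) (hd : 2 ≤ d) :
    |akAp I d H - 2 * ((akSet I d H).ncard : ℝ)| ≤ d * ((2*H+1)^d + (akBad d H).card) := by
  classical
  have e : 2 * ((akSet I d H).ncard : ℝ) = ∑ v ∈ akIrr d H, (akN I (akPoly v) : ℝ) := by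
    exact_mod_cast (ak_double I d H hd).symm
  have hsub : akIrr d H ⊆ (akBox (d+1) H).filter (fun v => akG v = 1) := by
    intro v hv
    simp only [akIrr, Finset.mem_filter] at hv ⊢
    exact ⟨hv.1, ak_G_of_irr d hd v hv.2.1 hv.2.2⟩
  rw [e, akAp, ← Finset.sum_sdiff hsub, add_sub_cancel_right, abs_of_nonneg
    (Finset.sum_nonneg fun _ _ => by positivity)]
  have hs2 : (akBox (d+1) H).filter (fun v => akG v = 1) \ akIrr d H ⊆
      ((akBox (d+1) H).filter fun v => v (Fin.last d) = 0) ∪ akBad d H := by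
    intro v hv
    simp only [akIrr, akBad, Finset.mem_filter, Finset.mem_sdiff, Finset.mem_union] at hv ⊢
    obtain ⟨⟨hb, hg⟩, hn⟩ := hv
    by_cases hD : (akPoly v).natDegree = d
    · right
      exact ⟨hb, hg, hD, fun h => hn ⟨hb, hD, h⟩⟩
    · left
      refine ⟨hb, ?_⟩
      have h1 : (akPoly v).coeff d = 0 := by
        apply Polynomial.coeff_eq_zero_of_natDegree_lt
        have := ak_natDegree v
        omega
      rw [ak_coeff, dif_pos (by omega)] at h1
      exact h1
  have hc := (Finset.card_le_card hs2).trans (Finset.card_union_le _ _)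
  have hc2 := hc.trans (Nat.add_le_add_right (ak_card_last d H) _)
  calc _ ≤ ∑ v ∈ (akBox (d+1) H).filter (fun v => akG v = 1) \ akIrr d H, (d:ℝ) :=
        Finset.sum_le_sum fun v _ => by exact_mod_cast ak_N_le I v
    _ = d * (((akBox (d+1) H).filter (fun v => akG v = 1) \ akIrr d H).card : ℝ) := by
      rw [Finset.sum_const, nsmul_eq_mul, mul_comm]
    _ ≤ _ := by
      gcongr
      exact_mod_cast hc2

lemma ak_total (I : Set ℝ) (d H : ℕ) (hd : 2 ≤ d) (hH : 2 ≤ H) (hI : I ⊆ Icc 0 1)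
    (hc : I.OrdConnected) :
    |2 * ((akSet I d H).ncard : ℝ) - (H:ℝ)^(d+1) * (∫ x in I, rho d x) / zetaR (d+1)| ≤
      (60 * (d:ℝ)^3 * 3^d + 2 * d * 3^d +
        14 * d^2 * ((d:ℝ)+1) * 3^(d+1) * (2^d * ((d:ℝ)+1))^d) *
        ((H:ℝ)^d * Real.log H ^ lfun d) := by
  have h1 := ak_Ap_asymp d H hd (by omega) I hI hc
  have h2 := ak_irr_diff I d H hd
  have h3 := ak_card_bad' d H hd hH
  have hH' : (2:ℝ) ≤ H := by exact_mod_cast hH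
  have hl : 1 ≤ 2 * Real.log H ^ lfun d := by
    unfold lfun
    split_ifs
    · have h2 : Real.log 2 ≤ Real.log H := Real.log_le_log (by norm_num) hH'
      have h3 := Real.log_two_gt_d9
      norm_num at h3 ⊢
      linarith
    · norm_num
  have h4 : (2*(H:ℝ)+1)^d ≤ 3^d * (H:ℝ)^d := by
    rw [← mul_pow]
    gcongr
    linarith
  have h5 : (H:ℝ)^d ≤ 2 * ((H:ℝ)^d * Real.log H ^ lfun d) := by
    have : 0 ≤ (H:ℝ)^d := by positivity
    nlinarith
  set X := (H:ℝ)^d * Real.log H ^ lfun d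
  rw [abs_sub_comm] at h2
  refine (abs_sub_le _ (akAp I d H) _).trans ((add_le_add h2 h1).trans ?_)
  calc _ ≤ (d:ℝ) * (3^d * (2 * X) + 14 * d * ((d:ℝ)+1) * 3^(d+1) * (2^d * ((d:ℝ)+1))^d * X)
      + 30 * (d:ℝ)^3 * 3^d * (2 * X) := by
        gcongr
        exact h4.trans (by gcongr)
    _ = _ := by ring

lemma ak_sK_ge (d : ℕ) (hd : 2 ≤ d) : 8 + 5*d + 2*d^2 ≤ sK d := by
  unfold sK
  have h1 : 2 ≤ 2^(d+1) := by
    calc 2 = 2^1 := rfl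
      _ ≤ _ := Nat.pow_le_pow_right (by norm_num) (by omega)
  have h2 : (2*d+3)^2 ≤ (2*d+3)^(2^(d+1)) := Nat.pow_le_pow_right (by omega) h1
  have h3 : 1 ≤ d ^ ((16 ^ (d + 1) - 1) * ⌈Real.log d / Real.log 2⌉₊) :=
    Nat.one_le_pow _ _ (by omega)
  calc 8 + 5*d + 2*d^2 ≤ 3 * (2*d+3)^2 * 1 := by nlinarith
    _ ≤ _ := Nat.mul_le_mul (Nat.mul_le_mul_left _ h2) h3

lemma ak_pK_ge (d : ℕ) (hd : 2 ≤ d) : 2 ≤ pK d := by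
  unfold pK
  have h1 : 1 ≤ 4 ^ (d+1) := Nat.one_le_pow _ _ (by norm_num)
  have h2 : d^1 ≤ d^(4^(d+1)) := Nat.pow_le_pow_right (by omega) h1
  have h3 : 1 ≤ 4 ^ ((4 ^ (d + 1) - 1) / 3) := Nat.one_le_pow _ _ (by norm_num)
  calc 2 ≤ 1 * d^1 := by rw [pow_one]; omega
    _ ≤ _ := Nat.mul_le_mul h3 h2

lemma ak_K1_ge (d : ℕ) (hd : 2 ≤ d) : (2:ℝ)^(8 + 5*d + 2*d^2) ≤ K1 d := by
  have hp : (2:ℝ) ≤ pK d := by exact_mod_cast ak_pK_ge d hd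
  have hs := ak_sK_ge d hd
  have hd' : (1:ℝ) ≤ d := by exact_mod_cast (by omega : 1 ≤ d)
  unfold K1
  generalize pK d = p at *
  generalize sK d = s at *
  have h1 : (2:ℝ)^(8 + 5*d + 2*d^2) ≤ (2 * (p:ℝ) - 1)^s :=
    calc (2:ℝ)^(8 + 5*d + 2*d^2) ≤ 2^s := pow_le_pow_right₀ (by norm_num) hs
      _ ≤ _ := by gcongr; linarith
  have h0 : 0 ≤ (2 * (p:ℝ) - 1)^s := le_trans (by positivity) h1
  have h2 : (1:ℝ) ≤ 2^(d+2) * p := by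
    have : (1:ℝ) ≤ 2^(d+2) := one_le_pow₀ (by norm_num)
    nlinarith
  have h3 : 0 ≤ 12 * (d : ℝ) ^ 2 * 2 ^ (d * (d - 2)) * ((d : ℝ) + 1) ^ ((d : ℝ) / 2) := by
    positivity
  have h4 : (2 * (p:ℝ) - 1)^s ≤ 2^(d+2) * p * (2 * (p:ℝ) - 1)^s := le_mul_of_one_le_left h0 h2
  have h5 := le_mul_of_one_le_left (add_nonneg h3 (h0.trans h4)) hd'
  linarith

lemma ak_const (d : ℕ) (hd : 2 ≤ d) : 60 * (d:ℝ)^3 * 3^d + 2 * d * 3^d +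
        14 * d^2 * ((d:ℝ)+1) * 3^(d+1) * (2^d * ((d:ℝ)+1))^d ≤ 2 * K1 d := by
  have hK := ak_K1_ge d hd
  have h1 : (d:ℝ) + 1 ≤ 2^d := by exact_mod_cast Nat.lt_two_pow_self (n := d)
  have h1' : (d:ℝ) ≤ 2^d := by linarith
  have h2 : (3:ℝ)^d ≤ 2^(2*d) := by
    rw [pow_mul]; gcongr; norm_num
  have h3 : (3:ℝ)^(d+1) ≤ 2^(2*d+2) := by
    rw [show 2*d+2 = 2*(d+1) by ring, pow_mul]; gcongr; norm_num
  have m : ∀ a b : ℕ, a ≤ b → (2:ℝ)^a ≤ 2^b := fun a b h => pow_le_pow_right₀ (by norm_num) h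
  have t1 : 60 * (d:ℝ)^3 * 3^d ≤ 2^(6+5*d+2*d^2) :=
    calc 60 * (d:ℝ)^3 * 3^d ≤ 2^6 * (2^d)^3 * 2^(2*d) := by gcongr; norm_num
      _ = 2^(6+5*d) := by ring
      _ ≤ _ := m _ _ (by omega)
  have t2 : 2 * (d:ℝ) * 3^d ≤ 2^(6+5*d+2*d^2) :=
    calc 2 * (d:ℝ) * 3^d ≤ 2 * 2^d * 2^(2*d) := by gcongr
      _ = 2^(1+3*d) := by ring
      _ ≤ _ := m _ _ (by omega)
  have t3 : 14 * (d:ℝ)^2 * ((d:ℝ)+1) * 3^(d+1) * (2^d * ((d:ℝ)+1))^d ≤ 2^(6+5*d+2*d^2) :=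
    calc 14 * (d:ℝ)^2 * ((d:ℝ)+1) * 3^(d+1) * (2^d * ((d:ℝ)+1))^d
        ≤ 2^4 * (2^d)^2 * 2^d * 2^(2*d+2) * (2^d * 2^d)^d := by gcongr; norm_num
      _ = 2^(6+5*d+2*d^2) := by
        simp only [← pow_mul, ← pow_add]
        congr 1
        ring
  have e : (2:ℝ)^(8 + 5*d + 2*d^2) = 4 * 2^(6+5*d+2*d^2) := by
    rw [show 8 + 5*d + 2*d^2 = 2 + (6+5*d+2*d^2) by ring, pow_add]; norm_num
  have : (0:ℝ) < 2^(6+5*d+2*d^2) := by positivity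
  linarith

theorem stmt15 (d : ℕ) (hd : 2 ≤ d) (H : ℕ) (hH : 2 ≤ H) (hy : yd d H ≤ 1 / 2) :
    ∀ I : Set ℝ, I ⊆ Set.Icc 0 1 → I.OrdConnected →
      |lambdaP d H I - ∫ x in I, chiF d x| ≤ 5 * yd d H := by
  intro I hI hc
  have hH' : (2:ℝ) ≤ H := by exact_mod_cast hH
  have hH0 : (0:ℝ) < H := by linarith
  have hJpos : 0 < ∫ x in (0:ℝ)..1, rho d x := by
    obtain ⟨v, hv, hvr⟩ := ak_rho_pos d hd
    have hi : IntegrableOn (rho d) (Icc 0 1) := ak_rho_int d _ subset_rfl measurableSet_Icc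
    have hii : IntervalIntegrable (rho d) volume 0 1 := by
      rw [intervalIntegrable_iff_integrableOn_Icc_of_le (by norm_num)]
      exact hi
    have := intervalIntegral.integral_mono_on (a := (0:ℝ)) (b := 1) (f := fun _ => v) (by norm_num)
      (by simp) hii hvr
    simp at this
    linarith
  have hJ : ∫ x in Icc (0:ℝ) 1, rho d x = ∫ x in (0:ℝ)..1, rho d x := by
    rw [intervalIntegral.integral_of_le (by norm_num), integral_Icc_eq_integral_Ioc]
  have hcK : 0 < cK d := inv_pos.2 hJpos
  have hcJ : cK d * ∫ x in Icc (0:ℝ) 1, rho d x = 1 := by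
    rw [hJ, cK]; exact inv_mul_cancel₀ hJpos.ne'
  have hz : 0 < zetaR (d+1) := lt_of_lt_of_le one_pos (ak_zeta_ge _ (by omega))
  have hlog : 0 ≤ Real.log H ^ lfun d := pow_nonneg (Real.log_nonneg (by linarith)) _
  have key : ∀ A : Set ℝ, A ⊆ Icc 0 1 → A.OrdConnected →
      |((akSet A d H).ncard : ℝ) * (2 * zetaR (d+1) * cK d / (H:ℝ)^(d+1)) -
        cK d * ∫ x in A, rho d x| ≤ yd d H := by
    intro A hA hAc
    have h := (ak_total A d H hd hH hA hAc).trans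
      (mul_le_mul_of_nonneg_right (ak_const d hd) (by positivity))
    have hs : 0 ≤ zetaR (d+1) * cK d / (H:ℝ)^(d+1) := by positivity
    have h2 := mul_le_mul_of_nonneg_left h hs
    rw [← abs_of_nonneg hs, ← abs_mul, abs_of_nonneg hs] at h2
    have e1 : zetaR (d+1) * cK d / (H:ℝ)^(d+1) * (2 * ((akSet A d H).ncard : ℝ) -
        (H:ℝ)^(d+1) * (∫ x in A, rho d x) / zetaR (d+1)) =
        ((akSet A d H).ncard : ℝ) * (2 * zetaR (d+1) * cK d / (H:ℝ)^(d+1)) -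
        cK d * ∫ x in A, rho d x := by
      field_simp
    have e2 : zetaR (d+1) * cK d / (H:ℝ)^(d+1) * (2 * K1 d * ((H:ℝ)^d * Real.log H ^ lfun d)) =
        yd d H := by
      unfold yd
      field_simp
      ring
    rw [e1, e2] at h2
    exact h2
  have kI := key I hI hc
  have k0 := key (Icc 0 1) subset_rfl ordConnected_Icc
  rw [hcJ] at k0
  set t := 2 * zetaR (d+1) * cK d / (H:ℝ)^(d+1) with ht
  have ht0 : 0 < t := by positivity
  have eI : {α : ℝ | α ∈ algSet d H ∧ α ∈ Set.Icc 0 1 ∧ α ∈ I} = akSet I d H := by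
    ext a
    simp only [akSet, Set.mem_ofPred_eq]
    constructor
    · rintro ⟨h1, _, h2⟩; exact ⟨h1, h2⟩
    · rintro ⟨h1, h2⟩; exact ⟨h1, hI h2, h2⟩
  have e0 : algSet d H ∩ Set.Icc 0 1 = akSet (Icc 0 1) d H := rfl
  have hchi : ∫ x in I, chiF d x = cK d * ∫ x in I, rho d x := by
    simp only [chiF]
    rw [integral_const_mul]
  have hmono : ((akSet I d H).ncard : ℝ) ≤ ((akSet (Icc 0 1) d H).ncard : ℝ) := by
    have hfin : (akSet (Icc 0 1) d H).Finite := by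
      rw [← ak_fin_coe _ d H hd]; exact Finset.finite_toSet _
    have hs : akSet I d H ⊆ akSet (Icc 0 1) d H := fun a ha => ⟨ha.1, hI ha.2⟩
    exact_mod_cast Set.ncard_le_ncard hs hfin
  have hn0 : (0:ℝ) ≤ ((akSet I d H).ncard : ℝ) := by positivity
  unfold lambdaP
  rw [eI, e0, hchi]
  generalize ((akSet I d H).ncard : ℝ) = n at *
  generalize ((akSet (Icc 0 1) d H).ncard : ℝ) = N at *
  have hy0 : 0 ≤ yd d H := le_trans (abs_nonneg _) kI
  generalize yd d H = y at *
  generalize (cK d * ∫ x in I, rho d x) = J at *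
  have hb := abs_le.1 k0
  have hbp : 0 < N * t := by linarith
  have hN : 0 < N := pos_of_mul_pos_left hbp ht0.le
  have e : n / N - n * t = (n / N) * (1 - N * t) := by
    field_simp
  have h1 : |n / N - n * t| ≤ y := by
    rw [e, abs_mul, abs_of_nonneg (by positivity), abs_sub_comm]
    have : n / N ≤ 1 := (div_le_one hN).2 hmono
    calc _ ≤ 1 * y := by gcongr
      _ = y := one_mul y
  have := abs_sub_le (n / N) (n * t) J
  linarith
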